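/- Every 3-edge-colorable graph with maximum degree 3 on n vertices admits a straight-line RAC drawing of O(n²) area (in fact with all vertices on integer grid points inside a square of side 2n). -/

import Mathlib

open scoped Classical

noncomputable section

/-- A point of the Euclidean plane. -/
abbrev Pt : Type := ℝ × ℝ

/-- The segments with endpoints `a, b` and `c, d` are orthogonal:
their direction vectors have zero inner product. -/
def SegOrth (a b c d : Pt) : Prop :=
  (b.1 - a.1) * (d.1 - c.1) + (b.2 - a.2) * (d.2 - c.2) = 0

/-- The degree of a vertex in a simple graph. -/
def vdeg {V : Type*} (G : SimpleGraph V) (v : V) : ℕ := (G.neighborSet v).ncard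

/-- `M` is a matching in `G`: a set of edges of `G` that are pairwise non-adjacent. -/
def IsMatchingOn {V : Type*} (G : SimpleGraph V) (M : Set (Sym2 V)) : Prop :=
  M ⊆ G.edgeSet ∧ ∀ e ∈ M, ∀ f ∈ M, e ≠ f → ∀ v : V, v ∈ e → v ∉ f

/-- `G` is `k`-edge-colorable: its edge set is partitioned into `k` matchings. -/
def EdgeColorable {V : Type*} (G : SimpleGraph V) (k : ℕ) : Prop :=
  ∃ M : Fin k → Set (Sym2 V),
    (∀ i, IsMatchingOn G (M i)) ∧
    (∀ i j, i ≠ j → Disjoint (M i) (M j)) ∧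
    (⋃ i, M i) = G.edgeSet

/-- `p` is a straight-line RAC drawing of `G`: vertices are at pairwise distinct points,
each edge is the closed segment between its endpoints, no edge passes through another
vertex, edges sharing an endpoint meet only there, and any two edges with no common
endpoint that intersect do so orthogonally. -/
structure IsRACDrawing {V : Type*} (G : SimpleGraph V) (p : V → Pt) : Prop where
  inj : Function.Injective p
  vertex_off : ∀ u v w : V, G.Adj u v → w ≠ u → w ≠ v →
    p w ∉ segment ℝ (p u) (p v)
  shared : ∀ u v w : V, G.Adj u v → G.Adj u w → v ≠ w →
    segment ℝ (p u) (p v) ∩ segment ℝ (p u) (p w) ⊆ {p u}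
  rac : ∀ u v u' v' : V, G.Adj u v → G.Adj u' v' →
    u ≠ u' → u ≠ v' → v ≠ u' → v ≠ v' →
    (segment ℝ (p u) (p v) ∩ segment ℝ (p u') (p v')).Nonempty →
    SegOrth (p u) (p v) (p u') (p v')

/-- All points of `P` are integer grid points lying in an axis-aligned square
of side length `side`. -/
def InGridSquare (side : ℝ) (P : Set Pt) : Prop :=
  (∀ q ∈ P, ∃ a b : ℤ, q = ((a : ℝ), (b : ℝ))) ∧
  ∃ x0 y0 : ℝ, ∀ q ∈ P, x0 ≤ q.1 ∧ q.1 ≤ x0 + side ∧ y0 ≤ q.2 ∧ q.2 ≤ y0 + side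

/-- The list of consecutive segments (as pairs of endpoints) of a polyline given
by its list of points. -/
def polySegs (l : List Pt) : List (Pt × Pt) := l.zip l.tail

/-- The set of plane points covered by a polyline given by its list of points. -/
def polySet (l : List Pt) : Set Pt := ⋃ s ∈ polySegs l, segment ℝ s.1 s.2

/-- `p, poly` is a `k`-bend RAC drawing of `G`: each edge `e` is drawn as the polyline
through the list of points `poly e` (at most `k + 1` segments, i.e. at most `k + 2`
points) joining the two endpoints of `e`; no edge passes through another vertex; edges
sharing an endpoint meet only at that endpoint; any two distinct edges intersect in
finitely many points; and wherever segments of two distinct edges meet (other than at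
the point of a common endvertex) the two segments are orthogonal. -/
structure IsBendRACDrawing {V : Type*} (k : ℕ) (G : SimpleGraph V)
    (p : V → Pt) (poly : Sym2 V → List Pt) : Prop where
  inj : Function.Injective p
  ends : ∀ e ∈ G.edgeSet, ∃ u v : V, e = s(u, v) ∧
    (poly e).head? = some (p u) ∧ (poly e).getLast? = some (p v)
  nsegs : ∀ e ∈ G.edgeSet, 2 ≤ (poly e).length ∧ (poly e).length ≤ k + 2
  vertex_off : ∀ e ∈ G.edgeSet, ∀ w : V, w ∉ e → p w ∉ polySet (poly e)
  shared : ∀ e ∈ G.edgeSet, ∀ e' ∈ G.edgeSet, e ≠ e' → ∀ w : V, w ∈ e → w ∈ e' →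
    polySet (poly e) ∩ polySet (poly e') ⊆ {p w}
  fin_inter : ∀ e ∈ G.edgeSet, ∀ e' ∈ G.edgeSet, e ≠ e' →
    (polySet (poly e) ∩ polySet (poly e')).Finite
  rac : ∀ e ∈ G.edgeSet, ∀ e' ∈ G.edgeSet, e ≠ e' →
    ∀ s ∈ polySegs (poly e), ∀ s' ∈ polySegs (poly e'),
    ∀ x : Pt, x ∈ segment ℝ s.1 s.2 → x ∈ segment ℝ s'.1 s'.2 →
    (∀ w : V, w ∈ e → w ∈ e' → x ≠ p w) →
    SegOrth s.1 s.2 s'.1 s'.2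

/-- All vertex points and bend points of a polyline drawing. -/
def drawingPoints {V : Type*} (G : SimpleGraph V) (p : V → Pt)
    (poly : Sym2 V → List Pt) : Set Pt :=
  Set.range p ∪ {q | ∃ e ∈ G.edgeSet, q ∈ poly e}

/-- `F` is (the edge set of) a 2-factor of `G`: a spanning subgraph in which every
vertex has degree exactly 2. -/
def Is2Factor {V : Type*} (G : SimpleGraph V) (F : Set (Sym2 V)) : Prop :=
  F ⊆ G.edgeSet ∧ ∀ v : V, {e ∈ F | v ∈ e}.ncard = 2

/-- The connected components of the (2-regular) spanning subgraph with edge set `F`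
that are odd cycles, i.e. have an odd number of vertices. -/
def oddComps {V : Type*} (F : Set (Sym2 V)) :
    Set ((SimpleGraph.fromEdgeSet F).ConnectedComponent) :=
  {C | Odd C.supp.ncard}

/-- `G` has oddness `k`: the minimum over all 2-factors of the number of odd-cycle
components equals `k` (in particular a 2-factor exists). -/
def HasOddness {V : Type*} (G : SimpleGraph V) (k : ℕ) : Prop :=
  (∃ F, Is2Factor G F ∧ (oddComps F).ncard = k) ∧
  (∀ F, Is2Factor G F → k ≤ (oddComps F).ncard)

/-- `G` has no cut-edge. -/
def Bridgeless {V : Type*} (G : SimpleGraph V) : Prop := ∀ e, ¬ G.IsBridge e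

/-! ### Combinatorial part: coordinates from two alternating orders -/

section Comb
set_option linter.unusedSectionVars false
variable {V : Type} [Fintype V]

/-- Closed under two maps. -/
def Clo2 (f g : V → V) (P : Set V) : Prop := ∀ v ∈ P, f v ∈ P ∧ g v ∈ P

/-- The class of `a` under two maps. -/
def cls (f g : V → V) (a : V) : Set V := {v | ∀ P, Clo2 f g P → a ∈ P → v ∈ P}

lemma cls_clo (f g : V → V) (a : V) : Clo2 f g (cls f g a) := by
  intro v hv
  exact ⟨fun P hP ha => (hP v (hv P hP ha)).1, fun P hP ha => (hP v (hv P hP ha)).2⟩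

lemma cls_self (f g : V → V) (a : V) : a ∈ cls f g a := fun _ _ ha => ha

lemma Clo2.compl {f g : V → V} (hf : ∀ v, f (f v) = v) (hg : ∀ v, g (g v) = v) {P : Set V}
    (hP : Clo2 f g P) : Clo2 f g Pᶜ := by
  intro v hv
  refine ⟨fun h => hv ?_, fun h => hv ?_⟩
  · have := (hP _ h).1
    rwa [hf] at this
  · have := (hP _ h).2
    rwa [hg] at this

/-- One-dimensional data: columns are the `f`-classes, `c` the closing `g`-edges. -/
structure Core (f g : V → V) (X : Finset V) (x : V → ℕ) (k : ℕ) (c : Set V) : Prop where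
  cf : ∀ v ∈ X, f v ∈ X
  cg : ∀ v ∈ X, g v ∈ X
  lt : ∀ v ∈ X, x v < k
  xf : ∀ v ∈ X, x (f v) = x v
  inj : ∀ u ∈ X, ∀ v ∈ X, x u = x v → u = v ∨ u = f v
  csub : ∀ u ∈ c, u ∈ X
  cgc : ∀ u ∈ c, g u ∈ c
  nc : ∀ u ∈ X, u ∉ c → g u ≠ u → x (g u) = x u + 1 ∨ x u = x (g u) + 1
  uniq : ∀ u ∈ X, ∀ v ∈ X, u ∉ c → v ∉ c → x (g u) = x u + 1 → x (g v) = x v + 1 →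
    x u = x v → u = v
  lam : ∀ u ∈ c, ∀ s ∈ X, min (x u) (x (g u)) ≤ x s → x s ≤ max (x u) (x (g u)) →
    min (x u) (x (g u)) ≤ x (g s) ∧ x (g s) ≤ max (x u) (x (g u))
  card : 2 * k ≤ X.card + (X.filter (fun v => f v = v)).card

/-- Partially explored alternating path. -/
structure PartPath (f g : V → V) (a : V) (P : Finset V) (x : V → ℕ) (k : ℕ) (z : V) : Prop where
  aP : a ∈ P
  sub : ∀ v ∈ P, v ∈ cls f g a
  cf : ∀ v ∈ P, f v ∈ P
  lt : ∀ v ∈ P, x v < k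
  xf : ∀ v ∈ P, x (f v) = x v
  inj : ∀ u ∈ P, ∀ v ∈ P, x u = x v → u = v ∨ u = f v
  xa : x a = 0
  zP : z ∈ P
  xz : x z + 1 = k
  good : ∀ u ∈ P, u = z ∨ (u = a ∧ f a ≠ a) ∨
    (g u ∈ P ∧ (x (g u) = x u + 1 ∨ x u = x (g u) + 1) ∧ (f z = z ∨ g u ≠ z))
  uniq : ∀ u ∈ P, ∀ v ∈ P, (u = a → f a = a) → (v = a → f a = a) → g u ∈ P → g v ∈ P →
    x (g u) = x u + 1 → x (g v) = x v + 1 → x u = x v → u = v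
  card : 2 * k ≤ P.card + (P.filter (fun v => f v = v)).card

lemma part_init (f g : V → V) (hf : ∀ v, f (f v) = v) (a : V) :
    PartPath f g a {a, f a} (fun _ => 0) 1 (f a) where
  aP := by simp
  sub := by
    intro v hv
    simp only [Finset.mem_insert, Finset.mem_singleton] at hv
    rcases hv with rfl | rfl
    · exact cls_self _ _ _
    · exact (cls_clo f g a a (cls_self _ _ _)).1
  cf := by
    intro v hv
    simp only [Finset.mem_insert, Finset.mem_singleton] at hv ⊢
    rcases hv with rfl | rfl
    · simp
    · simp [hf]
  lt := by simp
  xf := by simp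
  inj := by
    intro u hu v hv _
    simp only [Finset.mem_insert, Finset.mem_singleton] at hu hv
    rcases hu with rfl | rfl <;> rcases hv with rfl | rfl <;> simp [hf]
  xa := rfl
  zP := by simp
  xz := by simp
  good := by
    intro u hu
    simp only [Finset.mem_insert, Finset.mem_singleton] at hu
    by_cases h : f a = a
    · left; rcases hu with rfl | rfl <;> simp [h]
    · rcases hu with rfl | rfl
      · right; left; exact ⟨rfl, h⟩
      · left; rfl
  uniq := by
    intro u _ v _ _ _ _ _ h
    simp at h
  card := by
    by_cases h : f a = a
    · simp [h, Finset.filter_singleton]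
    · rw [Finset.card_pair (Ne.symm h)]; omega

lemma part_step (f g : V → V) (hf : ∀ v, f (f v) = v) (hg : ∀ v, g (g v) = v) (a : V)
    (P : Finset V) (x : V → ℕ) (k : ℕ) (z : V) (hP : PartPath f g a P x k z) (hz : g z ∉ P) :
    PartPath f g a (P ∪ {g z, f (g z)}) (fun v => if v ∈ P then x v else k) (k + 1) (f (g z)) := by
  have hfz : f (g z) ∉ P := fun h => hz (by have := hP.cf _ h; rwa [hf] at this)
  have hmem : ∀ u, u ∈ P ∪ {g z, f (g z)} → u ∈ P ∨ (u ∉ P ∧ (u = g z ∨ u = f (g z))) := by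
    intro u hu
    by_cases h : u ∈ P
    · exact Or.inl h
    · right; refine ⟨h, ?_⟩
      simpa [h] using hu
  have hin : ∀ u ∈ P, u ∈ P ∪ {g z, f (g z)} := fun u hu => Finset.mem_union_left _ hu
  have hgz : g z ∈ P ∪ {g z, f (g z)} := by simp
  have hzn : f (g z) ∈ P ∪ {g z, f (g z)} := by simp
  have ha := hP.aP
  have hzP := hP.zP
  have low : ∀ u ∈ P ∪ {g z, f (g z)}, (u = a → f a = a) → g u ∈ P ∪ {g z, f (g z)} →
      (if g u ∈ P then x (g u) else k) = (if u ∈ P then x u else k) + 1 →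
      (u ∈ P ∧ g u ∈ P ∧ x (g u) = x u + 1) ∨ (u = z ∧ ∃ u ∈ P, x u + 1 = k) := by
    intro u hu hua hgu hx
    by_cases h1 : u ∈ P
    · by_cases h2 : g u ∈ P
      · left; simp only [h1, h2, if_true] at hx; exact ⟨h1, h2, hx⟩
      · right
        rcases hP.good u h1 with h | ⟨h, h'⟩ | h
        · exact ⟨h, z, hzP, hP.xz⟩
        · exact absurd (hua h) h'
        · exact absurd h.1 h2
    · simp only [h1, if_false] at hx
      by_cases h2 : g u ∈ P
      · simp only [h2, if_true] at hx
        have := hP.lt _ h2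
        omega
      · simp only [h2, if_false] at hx
        omega
  constructor
  · exact hin _ ha
  · intro v hv
    have hc : g z ∈ cls f g a := (cls_clo f g a z (hP.sub z hzP)).2
    rcases hmem v hv with h | ⟨_, rfl | rfl⟩
    · exact hP.sub v h
    · exact hc
    · exact (cls_clo f g a _ hc).1
  · intro v hv
    rcases hmem v hv with h | ⟨_, rfl | rfl⟩
    · exact hin _ (hP.cf v h)
    · exact hzn
    · rw [hf]; exact hgz
  · intro v hv
    rcases hmem v hv with h | ⟨h, _⟩
    · have := hP.lt v h
      simp only [h, if_true]; omega
    · simp only [h, if_false]; omega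
  · intro v hv
    rcases hmem v hv with h | ⟨h, h'⟩
    · simp only [h, hP.cf v h, if_true]; exact hP.xf v h
    · have : f v ∉ P := fun h2 => h (by have := hP.cf _ h2; rwa [hf] at this)
      simp only [h, this, if_false]
  · intro u hu v hv huv
    rcases hmem u hu with h | ⟨h, h'⟩ <;> rcases hmem v hv with h2 | ⟨h2, h2'⟩
    · simp only [h, h2, if_true] at huv
      exact hP.inj u h v h2 huv
    · simp only [h, h2, if_true, if_false] at huv
      have := hP.lt u h; omega
    · simp only [h, h2, if_true, if_false] at huv
      have := hP.lt v h2; omega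
    · rcases h' with rfl | rfl <;> rcases h2' with rfl | rfl <;> simp [hf]
  · simp only [ha, if_true]; exact hP.xa
  · exact hzn
  · simp only [hfz, if_false]
  · intro u hu
    rcases hmem u hu with h | ⟨h, h'⟩
    · rcases hP.good u h with rfl | h3 | ⟨h3, h4, h5⟩
      · right; right
        refine ⟨hgz, ?_, ?_⟩
        · left; simp only [h, hz, if_true, if_false]; exact hP.xz.symm
        · by_cases h6 : f (g u) = g u
          · left; rw [h6, h6]
          · right; exact fun h7 => h6 h7.symm
      · right; left; exact h3
      · right; right
        refine ⟨hin _ h3, ?_, ?_⟩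
        · simp only [h, h3, if_true]; exact h4
        · right; intro h7; exact hfz (h7 ▸ h3)
    · rcases h' with rfl | rfl
      · right; right
        rw [hg]
        refine ⟨hin _ hzP, ?_, ?_⟩
        · right; simp only [hz, hzP, if_true, if_false]; exact hP.xz.symm
        · right; intro h7; exact hfz (h7 ▸ hzP)
      · left; rfl
  · intro u hu v hv hua hva hgu hgv h1 h2 h3
    rcases low u hu hua hgu h1 with ⟨hu1, hu2, hu3⟩ | ⟨rfl, hu2⟩ <;>
      rcases low v hv hva hgv h2 with ⟨hv1, hv2, hv3⟩ | ⟨rfl, hv2⟩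
    · simp only [hu1, hv1, if_true] at h3
      exact hP.uniq u hu1 v hv1 hua hva hu2 hv2 hu3 hv3 h3
    · simp only [hu1, hzP, if_true] at h3
      have := hP.lt _ hu2
      have := hP.xz
      omega
    · simp only [hv1, hzP, if_true] at h3
      have := hP.lt _ hv2
      have := hP.xz
      omega
    · rfl
  · have hd : Disjoint P {g z, f (g z)} := by
      rw [Finset.disjoint_right]
      intro u hu
      simp only [Finset.mem_insert, Finset.mem_singleton] at hu
      rcases hu with rfl | rfl <;> assumption
    rw [Finset.filter_union, Finset.card_union_of_disjoint hd,
      Finset.card_union_of_disjoint (Finset.disjoint_filter_filter hd)]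
    have := hP.card
    have h2 : 2 ≤ ({g z, f (g z)} : Finset V).card +
        (({g z, f (g z)} : Finset V).filter (fun v => f v = v)).card := by
      by_cases h : f (g z) = g z
      · simp [h, Finset.filter_singleton]
      · rw [Finset.card_pair (Ne.symm h)]; omega
    omega

lemma part_end (f g : V → V) (hf : ∀ v, f (f v) = v) (hg : ∀ v, g (g v) = v) (a : V) :
    ∃ P x k z, PartPath f g a P x k z ∧ g z ∈ P := by
  have key : ∀ n : ℕ, ∀ P x k z, PartPath f g a P x k z → Fintype.card V - P.card ≤ n →
      ∃ P x k z, PartPath f g a P x k z ∧ g z ∈ P := by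
    intro n
    induction n with
    | zero =>
      intro P x k z hP hn
      have : P = Finset.univ := by
        apply Finset.eq_univ_of_card
        have := Finset.card_le_univ P
        omega
      exact ⟨P, x, k, z, hP, by simp [this]⟩
    | succ n ih =>
      intro P x k z hP hn
      by_cases hz : g z ∈ P
      · exact ⟨P, x, k, z, hP, hz⟩
      · refine ih _ _ _ _ (part_step f g hf hg a P x k z hP hz) ?_
        have : P.card < (P ∪ {g z, f (g z)}).card := by
          apply Finset.card_lt_card
          refine ⟨Finset.subset_union_left, fun h => hz (h (by simp))⟩
        omega
  exact key _ _ _ _ _ (part_init f g hf a) le_rfl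

lemma orbit_path (f g : V → V) (hf : ∀ v, f (f v) = v) (hg : ∀ v, g (g v) = v) (a : V)
    (h : f a = a ∨ g a = a) :
    ∃ C x k z, Core f g C x k ∅ ∧ a ∈ C ∧ (∀ v ∈ C, v ∈ cls f g a) ∧ x a = 0 ∧ z ∈ C ∧
      x z + 1 = k ∧ (f z = z ∨ g z = z) := by
  obtain ⟨P, x, k, z, hP, hz⟩ := part_end f g hf hg a
  have hzz : g z = z ∨ (f z = z ∧ (x (g z) = x z + 1 ∨ x z = x (g z) + 1)) := by
    by_cases h1 : g z = z
    · exact Or.inl h1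
    · right
      rcases hP.good _ hz with h2 | ⟨h2, h3⟩ | ⟨h2, h3, h4⟩
      · exact absurd h2 h1
      · rcases h with h | h
        · exact absurd h h3
        · exfalso; apply h1
          rw [h2]
          have := hg z
          rw [h2, h] at this
          exact this
      · rw [hg] at h3 h4
        refine ⟨by simpa using h4, by tauto⟩
  have hall : ∀ u ∈ P, g u ∈ P ∧ (g u ≠ u → x (g u) = x u + 1 ∨ x u = x (g u) + 1) := by
    intro u hu
    rcases hP.good u hu with rfl | ⟨h2, h3⟩ | ⟨h2, h3, h4⟩
    · refine ⟨hz, fun h1 => ?_⟩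
      rcases hzz with h2 | h2
      · exact absurd h2 h1
      · exact h2.2
    · have h4 : g a = a := by tauto
      rw [h2, h4]
      exact ⟨hP.aP, fun h => absurd rfl h⟩
    · exact ⟨h2, fun _ => h3⟩
  refine ⟨P, x, k, z, ?_, hP.aP, hP.sub, hP.xa, hP.zP, hP.xz, by tauto⟩
  refine ⟨hP.cf, fun v hv => (hall v hv).1, hP.lt, hP.xf, hP.inj, by simp, by simp,
    fun u hu _ => (hall u hu).2, ?_, by simp, hP.card⟩
  intro u hu v hv _ _ h1 h2 h3
  have aux : ∀ w ∈ P, x (g w) = x w + 1 → w = a → f a = a := by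
    rintro w hw h5 rfl
    rcases h with h | h
    · exact h
    · rw [h] at h5; omega
  exact hP.uniq u hu v hv (aux u hu h1) (aux v hv h2) (hall u hu).1 (hall v hv).1 h1 h2 h3

lemma orbit_cycle (f g : V → V) (hf : ∀ v, f (f v) = v) (hg : ∀ v, g (g v) = v) (a : V)
    (h : ∀ v ∈ cls f g a, f v ≠ v ∧ g v ≠ v) :
    ∃ C x k, Core f g C x k {a, g a} ∧ a ∈ C ∧ (∀ v ∈ C, v ∈ cls f g a) := by
  obtain ⟨P, x, k, z, hP, hz⟩ := part_end f g hf hg a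
  have hfz := (h z (hP.sub z hP.zP)).1
  have hgz := (h z (hP.sub z hP.zP)).2
  have hza : g z = a := by
    rcases hP.good _ hz with h2 | ⟨h2, h3⟩ | ⟨h2, h3, h4⟩
    · exact absurd h2 hgz
    · exact h2
    · rw [hg] at h4; tauto
  have haz : g a = z := by rw [← hza, hg]
  have hall : ∀ u ∈ P, g u ∈ P ∧ (u = a ∨ u = z ∨ x (g u) = x u + 1 ∨ x u = x (g u) + 1) := by
    intro u hu
    rcases hP.good u hu with rfl | ⟨h2, h3⟩ | ⟨h2, h3, h4⟩
    · exact ⟨hz, by tauto⟩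
    · rw [h2, haz]; exact ⟨hP.zP, by tauto⟩
    · exact ⟨h2, by tauto⟩
  refine ⟨P, x, k, ?_, hP.aP, hP.sub⟩
  refine ⟨hP.cf, fun v hv => (hall v hv).1, hP.lt, hP.xf, hP.inj, ?_, ?_, ?_, ?_, ?_, hP.card⟩
  · rintro u (rfl | rfl)
    · exact hP.aP
    · rw [haz]; exact hP.zP
  · rintro u (rfl | rfl)
    · right; rfl
    · left; exact hg a
  · intro u hu hc _
    rw [haz] at hc
    have : u ≠ a ∧ u ≠ z := by simpa using hc
    have := (hall u hu).2
    tauto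
  · intro u hu v hv hu' hv' h1 h2 h3
    exact hP.uniq u hu v hv (fun h => absurd (Or.inl h) hu') (fun h => absurd (Or.inl h) hv')
      (hall u hu).1 (hall v hv).1 h1 h2 h3
  · intro u hu s hs _ _
    have h1 := hP.lt _ (hall s hs).1
    have h2 := hP.xz
    have h3 := hP.xa
    rcases hu with rfl | rfl
    · rw [haz]; omega
    · rw [hg, haz]; omega

end Comb
section Machine
set_option linter.unusedSectionVars false
variable {V : Type} [Fintype V]

/-- Closing edges lie below everything else in their range. -/
def Cross (g : V → V) (X Y : Finset V) (x y : V → ℕ) (c : Set V) : Prop :=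
  (∀ u ∈ c, u ∈ Y) ∧ ∀ u ∈ c, ∀ s ∈ X, s ∈ Y → s ≠ u → s ≠ g u →
    min (x u) (x (g u)) ≤ x s → x s ≤ max (x u) (x (g u)) → y u ≤ y s ∧ y (g u) ≤ y s

/-- State of the incremental construction. -/
def Stt (f h g : V → V) (X Y : Finset V) (x y : V → ℕ) (kx ky : ℕ) (cx cy : Set V) : Prop :=
  (Core f g X x kx cx ∧ Core h g Y y ky cy) ∧ (Cross g X Y x y cx ∧ Cross g Y X y x cy)

lemma Stt.swap {f h g : V → V} {X Y : Finset V} {x y : V → ℕ} {kx ky : ℕ} {cx cy : Set V}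
    (H : Stt f h g X Y x y kx ky cx cy) : Stt h f g Y X y x ky kx cy cx :=
  ⟨H.1.symm, H.2.symm⟩

/-- Extension of one coordinate. -/
def Exts (X : Finset V) (x : V → ℕ) (k : ℕ) (c : Set V) (X' : Finset V) (x' : V → ℕ)
    (c' : Set V) : Prop :=
  (∀ v ∈ X, v ∈ X' ∧ x' v = x v) ∧ (∀ v ∈ X', v ∉ X → k ≤ x' v) ∧ (∀ u ∈ c', u ∈ c ∨ k ≤ x' u)

lemma Exts.refl (X : Finset V) (x : V → ℕ) (k : ℕ) (c : Set V) : Exts X x k c X x c :=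
  ⟨fun v hv => ⟨hv, rfl⟩, fun v h h' => absurd h h', fun u hu => Or.inl hu⟩

lemma Exts.trans {X : Finset V} {x : V → ℕ} {k : ℕ} {c : Set V} {X' : Finset V} {x' : V → ℕ}
    {k' : ℕ} {c' : Set V} {X'' : Finset V} {x'' : V → ℕ} {c'' : Set V}
    (h1 : Exts X x k c X' x' c') (hk : k ≤ k') (h2 : Exts X' x' k' c' X'' x'' c'')
    (hc : ∀ u ∈ c', u ∈ X') :
    Exts X x k c X'' x'' c'' := by
  refine ⟨?_, ?_, ?_⟩
  · intro v hv
    obtain ⟨a, b⟩ := h1.1 v hv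
    obtain ⟨a', b'⟩ := h2.1 v a
    exact ⟨a', b'.trans b⟩
  · intro v hv hv'
    by_cases h : v ∈ X'
    · rw [(h2.1 v h).2]; exact h1.2.1 v h hv'
    · exact hk.trans (h2.2.1 v hv h)
  · intro u hu
    rcases h2.2.2 u hu with h | h
    · rcases h1.2.2 u h with h' | h'
      · exact Or.inl h'
      · right; rw [(h2.1 u (hc u h)).2]; exact h'
    · exact Or.inr (hk.trans h)

lemma stt_empty (f h g : V → V) : Stt f h g ∅ ∅ (fun _ => 0) (fun _ => 0) 0 0 ∅ ∅ := by
  refine ⟨⟨?_, ?_⟩, ?_, ?_⟩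
  · constructor <;> simp
  · constructor <;> simp
  · constructor <;> simp
  · constructor <;> simp

lemma stt_step {f h g : V → V} {X Y : Finset V} {x y : V → ℕ} {kx ky : ℕ} {cx cy : Set V}
    (H : Stt f h g X Y x y kx ky cx cy) {C : Finset V} {x0 : V → ℕ} {k : ℕ} {c0 : Set V}
    (hC : Core f g C x0 k c0) (hd : ∀ v ∈ C, v ∉ X)
    (hcr : Cross g C Y x0 y c0) :
    Stt f h g (X ∪ C) Y (fun v => if v ∈ C then kx + x0 v else x v) y (kx + k) ky (cx ∪ c0) cy ∧
    Exts X x kx cx (X ∪ C) (fun v => if v ∈ C then kx + x0 v else x v) (cx ∪ c0) := by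
  obtain ⟨⟨A, B⟩, E, F⟩ := H
  have hd' : ∀ v ∈ X, v ∉ C := fun v h1 h2 => hd v h2 h1
  have hm : ∀ v, v ∈ X ∪ C → (v ∈ X ∧ v ∉ C) ∨ v ∈ C := by
    intro v hv
    rcases Finset.mem_union.1 hv with h | h
    · exact Or.inl ⟨h, hd' v h⟩
    · exact Or.inr h
  have hX : ∀ v ∈ X, (fun v => if v ∈ C then kx + x0 v else x v) v = x v := by
    intro v hv; simp only [hd' v hv, if_false]
  have hCC : ∀ v ∈ C, (fun v => if v ∈ C then kx + x0 v else x v) v = kx + x0 v := by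
    intro v hv; simp only [hv, if_true]
  have hcXC : ∀ u ∈ X, u ∉ c0 := fun u hu hc => hd u (hC.csub u hc) hu
  have hcCX : ∀ u ∈ C, u ∉ cx := fun u hu hc => hd u hu (A.csub u hc)
  generalize hx' : (fun v => if v ∈ C then kx + x0 v else x v) = x' at hX hCC ⊢
  clear hx'
  refine ⟨⟨⟨?_, B⟩, ?_, ?_⟩, ?_⟩
  · constructor
    · intro v hv
      rcases hm v hv with ⟨h1, _⟩ | h1
      · exact Finset.mem_union_left _ (A.cf v h1)
      · exact Finset.mem_union_right _ (hC.cf v h1)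
    · intro v hv
      rcases hm v hv with ⟨h1, _⟩ | h1
      · exact Finset.mem_union_left _ (A.cg v h1)
      · exact Finset.mem_union_right _ (hC.cg v h1)
    · intro v hv
      rcases hm v hv with ⟨h1, _⟩ | h1
      · have := A.lt v h1; rw [hX v h1]; omega
      · have := hC.lt v h1; rw [hCC v h1]; omega
    · intro v hv
      rcases hm v hv with ⟨h1, _⟩ | h1
      · rw [hX v h1, hX _ (A.cf v h1)]; exact A.xf v h1
      · rw [hCC v h1, hCC _ (hC.cf v h1), hC.xf v h1]
    · intro u hu v hv huv
      rcases hm v hv with ⟨h1, _⟩ | h1 <;> rcases hm u hu with ⟨h2, _⟩ | h2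
      · rw [hX v h1, hX u h2] at huv; exact A.inj u h2 v h1 huv
      · rw [hX v h1, hCC u h2] at huv; have := A.lt v h1; omega
      · rw [hCC v h1, hX u h2] at huv; have := A.lt u h2; omega
      · rw [hCC v h1, hCC u h2] at huv; exact hC.inj u h2 v h1 (by omega)
    · rintro u (hu | hu)
      · exact Finset.mem_union_left _ (A.csub u hu)
      · exact Finset.mem_union_right _ (hC.csub u hu)
    · rintro u (hu | hu)
      · exact Or.inl (A.cgc u hu)
      · exact Or.inr (hC.cgc u hu)
    · intro u hu hc hg
      rcases hm u hu with ⟨h1, _⟩ | h1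
      · rw [hX u h1, hX _ (A.cg u h1)]; exact A.nc u h1 (fun h => hc (Or.inl h)) hg
      · rw [hCC u h1, hCC _ (hC.cg u h1)]
        have := hC.nc u h1 (fun h => hc (Or.inr h)) hg
        omega
    · intro u hu v hv hcu hcv
      rcases hm v hv with ⟨h1, _⟩ | h1 <;> rcases hm u hu with ⟨h2, _⟩ | h2
      · rw [hX v h1, hX u h2, hX _ (A.cg v h1), hX _ (A.cg u h2)]
        exact A.uniq u h2 v h1 (fun h => hcu (Or.inl h)) (fun h => hcv (Or.inl h))
      · rw [hX v h1, hCC u h2]; have := A.lt v h1; omega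
      · rw [hCC v h1, hX u h2]; have := A.lt u h2; omega
      · rw [hCC v h1, hCC u h2, hCC _ (hC.cg v h1), hCC _ (hC.cg u h2)]
        intro a1 a2 a3
        exact hC.uniq u h2 v h1 (fun h => hcu (Or.inr h)) (fun h => hcv (Or.inr h))
          (by omega) (by omega) (by omega)
    · intro u hu s hs
      rcases hu with hu | hu
      · have h2 := A.csub u hu
        have h3 := A.cg u h2
        rw [hX u h2, hX _ h3]
        rcases hm s hs with ⟨h1, _⟩ | h1
        · rw [hX s h1, hX _ (A.cg s h1)]; exact A.lam u hu s h1
        · rw [hCC s h1]; have := A.lt u h2; have := A.lt _ h3; omega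
      · have h2 := hC.csub u hu
        have h3 := hC.cg u h2
        rw [hCC u h2, hCC _ h3]
        rcases hm s hs with ⟨h1, _⟩ | h1
        · rw [hX s h1]; have := A.lt s h1; omega
        · rw [hCC s h1, hCC _ (hC.cg s h1)]
          have := hC.lam u hu s h1
          omega
    · have hdd : Disjoint X C := Finset.disjoint_left.2 hd'
      rw [Finset.filter_union, Finset.card_union_of_disjoint hdd,
        Finset.card_union_of_disjoint (Finset.disjoint_filter_filter hdd)]
      have := A.card
      have := hC.card
      omega
  · refine ⟨?_, ?_⟩
    · rintro u (hu | hu)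
      · exact E.1 u hu
      · exact hcr.1 u hu
    · intro u hu s hs hsY hsu hsg
      rcases hu with hu | hu
      · have h2 := A.csub u hu
        have h3 := A.cg u h2
        rw [hX u h2, hX _ h3]
        rcases hm s hs with ⟨h1, _⟩ | h1
        · rw [hX s h1]; exact E.2 u hu s h1 hsY hsu hsg
        · rw [hCC s h1]; have := A.lt u h2; have := A.lt _ h3; omega
      · have h2 := hC.csub u hu
        have h3 := hC.cg u h2
        rw [hCC u h2, hCC _ h3]
        rcases hm s hs with ⟨h1, _⟩ | h1
        · rw [hX s h1]; have := A.lt s h1; omega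
        · rw [hCC s h1]
          intro a1 a2
          exact hcr.2 u hu s h1 hsY hsu hsg (by omega) (by omega)
  · refine ⟨fun u hu => Finset.mem_union_left _ (F.1 u hu), ?_⟩
    intro u hu s hsY hs hsu hsg a1 a2
    have h2 := F.1 u hu
    have h3 := F.1 _ (B.cgc u hu)
    rw [hX u h2, hX _ h3]
    rcases hm s hs with ⟨h1, _⟩ | h1
    · rw [hX s h1]; exact F.2 u hu s hsY h1 hsu hsg a1 a2
    · rw [hCC s h1]; have := A.lt u h2; have := A.lt _ h3; omega
  · refine ⟨fun v hv => ⟨Finset.mem_union_left _ hv, hX v hv⟩, ?_, ?_⟩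
    · intro v hv hvX
      rcases hm v hv with ⟨h1, _⟩ | h1
      · exact absurd h1 hvX
      · rw [hCC v h1]; omega
    · rintro u (hu | hu)
      · exact Or.inl hu
      · right; rw [hCC u (hC.csub u hu)]; omega

/-- Adding a path class. -/
lemma stt_path {f h g : V → V} (hf : ∀ v, f (f v) = v) (hg : ∀ v, g (g v) = v)
    {X Y : Finset V} {x y : V → ℕ} {kx ky : ℕ} {cx cy : Set V}
    (H : Stt f h g X Y x y kx ky cx cy) (a : V) (ha : a ∉ X) (hfix : f a = a ∨ g a = a) :
    ∃ C x0 k z, Core f g C x0 k ∅ ∧ a ∈ C ∧ (∀ v ∈ C, v ∈ cls f g a) ∧ x0 a = 0 ∧ z ∈ C ∧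
      x0 z + 1 = k ∧ (f z = z ∨ g z = z) ∧
      Stt f h g (X ∪ C) Y (fun v => if v ∈ C then kx + x0 v else x v) y (kx + k) ky cx cy ∧
      Exts X x kx cx (X ∪ C) (fun v => if v ∈ C then kx + x0 v else x v) cx := by
  obtain ⟨C, x0, k, z, h1, h2, h3, h4, h5, h6, h7⟩ := orbit_path f g hf hg a hfix
  have hclo : Clo2 f g ((X : Set V)ᶜ) := by
    apply Clo2.compl hf hg
    intro v hv
    exact ⟨H.1.1.cf v hv, H.1.1.cg v hv⟩
  have hd : ∀ v ∈ C, v ∉ X := by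
    intro v hv hvX
    exact h3 v hv _ hclo ha hvX
  have := stt_step H h1 hd ⟨by simp, by simp⟩
  rw [Set.union_empty] at this
  exact ⟨C, x0, k, z, h1, h2, h3, h4, h5, h6, h7, this.1, this.2⟩

/-- Adding the class of a vertex of `Y`. -/
lemma stt_add {f h g : V → V} (hf : ∀ v, f (f v) = v) (hg : ∀ v, g (g v) = v)
    {X Y : Finset V} {x y : V → ℕ} {kx ky : ℕ} {cx cy : Set V}
    (H : Stt f h g X Y x y kx ky cx cy) (c : V) (hcX : c ∉ X) (hcY : c ∈ Y) :
    ∃ C x' k' c', c ∈ C ∧ (∀ v ∈ C, v ∈ cls f g c) ∧ kx ≤ k' ∧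
      Stt f h g (X ∪ C) Y x' y k' ky c' cy ∧ Exts X x kx cx (X ∪ C) x' c' := by
  have hclo : Clo2 f g ((X : Set V)ᶜ) := by
    apply Clo2.compl hf hg
    intro v hv
    exact ⟨H.1.1.cf v hv, H.1.1.cg v hv⟩
  have hsymm : ∀ e, e ∈ cls f g c → ∀ v, v ∈ cls f g e ↔ v ∈ cls f g c := by
    intro e he v
    constructor
    · intro hv P hP hc
      exact hv P hP (he P hP hc)
    · intro hv P hP hc
      refine hv P hP ?_
      by_contra hcP
      exact he Pᶜ (hP.compl hf hg) hcP hc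
  have hclX : ∀ v ∈ cls f g c, v ∉ X := fun v hv => hv _ hclo hcX
  by_cases hex : ∃ e ∈ cls f g c, f e = e ∨ g e = e
  · obtain ⟨e, he, hfix⟩ := hex
    obtain ⟨C, x0, k, z, h1, h2, h3, h4, h5, h6, h7, h8, h9⟩ :=
      stt_path hf hg H e (hclX e he) hfix
    refine ⟨C, _, _, _, ?_, ?_, ?_, h8, h9⟩
    · have : c ∈ cls f g e := (hsymm e he c).2 (cls_self _ _ _)
      exact this (C : Set V) (fun v hv => ⟨h1.cf v hv, h1.cg v hv⟩) h2
    · intro v hv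
      exact (hsymm e he v).1 (h3 v hv)
    · omega
  · push Not at hex
    have hne : (Y.filter (fun v => v ∈ cls f g c)).Nonempty :=
      ⟨c, by simp [hcY, cls_self]⟩
    obtain ⟨a, ha, hmin⟩ := Finset.exists_min_image _ y hne
    simp only [Finset.mem_filter] at ha hmin
    obtain ⟨haY, hac⟩ := ha
    obtain ⟨C, x0, k, h1, h2, h3⟩ := orbit_cycle f g hf hg a
      (fun v hv => hex v ((hsymm a hac v).1 hv))
    have hCc : ∀ v ∈ C, v ∈ cls f g c := fun v hv => (hsymm a hac v).1 (h3 v hv)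
    have hd : ∀ v ∈ C, v ∉ X := fun v hv => hclX v (hCc v hv)
    obtain ⟨⟨A, B⟩, E, F⟩ := H
    have hup : ∀ s ∈ C, s ∈ Y → y s = y a → y (g s) = y s + 1 ∧ s ∉ cy := by
      intro s hs hsY hys
      have hncy : s ∉ cy := fun h => hd s hs (F.1 s h)
      refine ⟨?_, hncy⟩
      rcases B.nc s hsY hncy (hex s (hCc s hs)).2 with h | h
      · exact h
      · have := hmin (g s) ⟨B.cg s hsY, hCc _ (h1.cg s hs)⟩
        omega
    obtain ⟨hga, hacy⟩ := hup a h2 haY rfl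
    have hcr : Cross g C Y x0 y {a, g a} := by
      refine ⟨?_, ?_⟩
      · rintro u (rfl | rfl)
        · exact haY
        · exact B.cg _ haY
      · intro u hu s hs hsY hsu hsg _ _
        have hsa : s ≠ a ∧ s ≠ g a := by
          rcases hu with rfl | rfl
          · exact ⟨hsu, hsg⟩
          · rw [hg] at hsg; exact ⟨hsg, hsu⟩
        have hys : y a < y s := by
          have h5 := hmin s ⟨hsY, hCc s hs⟩
          by_contra h6
          have h7 : y s = y a := by omega
          obtain ⟨h8, h9⟩ := hup s hs hsY h7
          exact hsa.1 (B.uniq s hsY a haY h9 hacy h8 hga h7)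
        rcases hu with rfl | rfl
        · omega
        · rw [hg]; omega
    have := stt_step ⟨⟨A, B⟩, E, F⟩ h1 hd hcr
    refine ⟨C, _, _, _, ?_, hCc, ?_, this.1, this.2⟩
    · have : c ∈ cls f g a := (hsymm a hac c).2 (cls_self _ _ _)
      exact this (C : Set V) (fun v hv => ⟨h1.cf v hv, h1.cg v hv⟩) h2
    · omega

/-- Closed under three maps. -/
def Clo3 (f h g : V → V) (P : Set V) : Prop := ∀ v ∈ P, f v ∈ P ∧ h v ∈ P ∧ g v ∈ P

lemma machine {f h g : V → V} (hf : ∀ v, f (f v) = v) (hh : ∀ v, h (h v) = v)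
    (hg : ∀ v, g (g v) = v) (T : Finset V) (hT : Clo3 f h g (T : Set V)) :
    ∀ n : ℕ, ∀ {X Y : Finset V} {x y : V → ℕ} {kx ky : ℕ} {cx cy : Set V},
    Stt f h g X Y x y kx ky cx cy → X ⊆ T → Y ⊆ T →
    (∀ P : Set V, Clo3 f h g P → (X : Set V) ⊆ P → (Y : Set V) ⊆ P → (T : Set V) ⊆ P) →
    (T.card - X.card) + (T.card - Y.card) ≤ n →
    ∃ x' y' kx' ky' cx' cy', Stt f h g T T x' y' kx' ky' cx' cy' ∧
      Exts X x kx cx T x' cx' ∧ Exts Y y ky cy T y' cy' := by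
  intro n
  induction n with
  | zero =>
    intro X Y x y kx ky cx cy H hX hY _ hn
    have h1 : X = T := Finset.eq_of_subset_of_card_le hX (by omega)
    have h2 : Y = T := Finset.eq_of_subset_of_card_le hY (by omega)
    subst h1
    subst h2
    exact ⟨x, y, kx, ky, cx, cy, H, Exts.refl _ _ _ _, Exts.refl _ _ _ _⟩
  | succ n ih =>
    intro X Y x y kx ky cx cy H hX hY hP hn
    by_cases hYX : ∃ c, c ∈ Y ∧ c ∉ X
    · obtain ⟨c, hcY, hcX⟩ := hYX
      obtain ⟨C, x', k', c', h1, h2, h3, h4, h5⟩ := stt_add hf hg H c hcX hcY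
      have hXC : X ∪ C ⊆ T := by
        apply Finset.union_subset hX
        intro v hv
        exact h2 v hv (T : Set V) (fun u hu => ⟨(hT u hu).1, (hT u hu).2.2⟩) (hY hcY)
      have hlt : X.card < (X ∪ C).card := Finset.card_lt_card
        ⟨Finset.subset_union_left, fun h => hcX (h (Finset.mem_union_right _ h1))⟩
      have hle := Finset.card_le_card hXC
      obtain ⟨x'', y'', kx'', ky'', cx'', cy'', h6, h7, h8⟩ := ih h4 hXC hY
        (fun P hPc hXP hYP => hP P hPc (fun v hv => hXP (by simp at hv ⊢; exact Or.inl hv)) hYP)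
        (by omega)
      exact ⟨x'', y'', kx'', ky'', cx'', cy'', h6, h5.trans h3 h7 h4.1.1.csub, h8⟩
    · by_cases hXY : ∃ c, c ∈ X ∧ c ∉ Y
      · obtain ⟨c, hcX, hcY⟩ := hXY
        obtain ⟨C, y', k', c', h1, h2, h3, h4, h5⟩ := stt_add hh hg H.swap c hcY hcX
        have hYC : Y ∪ C ⊆ T := by
          apply Finset.union_subset hY
          intro v hv
          exact h2 v hv (T : Set V) (fun u hu => ⟨(hT u hu).2.1, (hT u hu).2.2⟩) (hX hcX)
        have hlt : Y.card < (Y ∪ C).card := Finset.card_lt_card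
          ⟨Finset.subset_union_left, fun h => hcY (h (Finset.mem_union_right _ h1))⟩
        have hle := Finset.card_le_card hYC
        obtain ⟨x'', y'', kx'', ky'', cx'', cy'', h6, h7, h8⟩ := ih h4.swap hX hYC
          (fun P hPc hXP hYP => hP P hPc hXP (fun v hv => hYP (by simp at hv ⊢; exact Or.inl hv)))
          (by omega)
        exact ⟨x'', y'', kx'', ky'', cx'', cy'', h6, h7, h5.trans h3 h8 h4.1.1.csub⟩
      · push Not at hYX hXY
        have hEq : X = Y := Finset.Subset.antisymm (fun v hv => hXY v hv) (fun v hv => hYX v hv)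
        subst hEq
        have hsub := hP (X : Set V)
          (fun v hv => ⟨H.1.1.cf v hv, H.1.2.cf v hv, H.1.1.cg v hv⟩) subset_rfl subset_rfl
        have hXT : X = T := Finset.Subset.antisymm hX (by exact_mod_cast hsub)
        subst hXT
        exact ⟨x, y, kx, ky, cx, cy, H, Exts.refl _ _ _ _, Exts.refl _ _ _ _⟩

end Machine

section Geom
set_option linter.unusedSectionVars false
variable {V : Type} [Fintype V]

/-- Order conditions on the coordinates. -/
structure Geo (f h g : V → V) (S : Finset V) (X Y : V → ℤ) : Prop where
  cf : ∀ v ∈ S, f v ∈ S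
  ch : ∀ v ∈ S, h v ∈ S
  cg : ∀ v ∈ S, g v ∈ S
  e1 : ∀ u ∈ S, ∀ v ∈ S, X u = X v → u = v ∨ u = f v
  e1f : ∀ v ∈ S, X (f v) = X v
  e2 : ∀ u ∈ S, ∀ v ∈ S, Y u = Y v → u = v ∨ u = h v
  e2h : ∀ v ∈ S, Y (h v) = Y v
  g1 : ∀ u ∈ S, ∀ s ∈ S, X u < X s → X s < X (g u) → Y u ≤ Y s ∧ Y (g u) ≤ Y s
  g2 : ∀ u ∈ S, ∀ s ∈ S, Y u < Y s → Y s < Y (g u) → X u ≤ X s ∧ X (g u) ≤ X s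
  g3 : ∀ u ∈ S, ∀ s ∈ S, g u ≠ u → g s ≠ s → s ≠ u → s ≠ g u →
    (X u ≤ X s ∧ X u ≤ X (g s) ∧ X (g u) ≤ X s ∧ X (g u) ≤ X (g s)) ∨
    (X s ≤ X u ∧ X s ≤ X (g u) ∧ X (g s) ≤ X u ∧ X (g s) ≤ X (g u)) ∨
    (Y u ≤ Y s ∧ Y u ≤ Y (g s) ∧ Y (g u) ≤ Y s ∧ Y (g u) ≤ Y (g s)) ∨
    (Y s ≤ Y u ∧ Y s ≤ Y (g u) ∧ Y (g s) ≤ Y u ∧ Y (g s) ≤ Y (g u))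

lemma core_g3 {f h g : V → V} {T : Finset V} {x y : V → ℕ} {kx ky : ℕ} {cx cy : Set V}
    (hg : ∀ v, g (g v) = v)
    (H : Stt f h g T T x y kx ky cx cy) (u s : V) (hu : u ∈ T) (hs : s ∈ T)
    (hgu : g u ≠ u) (hgs : g s ≠ s) (h1 : s ≠ u) (h2 : s ≠ g u) :
    (x u ≤ x s ∧ x u ≤ x (g s) ∧ x (g u) ≤ x s ∧ x (g u) ≤ x (g s)) ∨
    (x s ≤ x u ∧ x s ≤ x (g u) ∧ x (g s) ≤ x u ∧ x (g s) ≤ x (g u)) ∨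
    (y u ≤ y s ∧ y u ≤ y (g s) ∧ y (g u) ≤ y s ∧ y (g u) ≤ y (g s)) ∨
    (y s ≤ y u ∧ y s ≤ y (g u) ∧ y (g s) ≤ y u ∧ y (g s) ≤ y (g u)) := by
  obtain ⟨⟨A, B⟩, E, F⟩ := H
  have h3 : g s ≠ u := fun h => h2 (by rw [← h, hg])
  have h4 : g s ≠ g u := fun h => h1 (by rw [← hg s, h, hg])
  have hmix : ∀ u s, u ∈ T → s ∈ T → s ≠ u → s ≠ g u → g s ≠ u → g s ≠ g u → u ∈ cx →
      (x u ≤ x s ∧ x u ≤ x (g s) ∧ x (g u) ≤ x s ∧ x (g u) ≤ x (g s)) ∨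
      (x s ≤ x u ∧ x s ≤ x (g u) ∧ x (g s) ≤ x u ∧ x (g s) ≤ x (g u)) ∨
      (y u ≤ y s ∧ y u ≤ y (g s) ∧ y (g u) ≤ y s ∧ y (g u) ≤ y (g s)) ∨
      ((x s < x u ∧ x u < x (g s) ∧ x s < x (g u) ∧ x (g u) < x (g s)) ∨
       (x (g s) < x u ∧ x u < x s ∧ x (g s) < x (g u) ∧ x (g u) < x s)) := by
    intro u s hu hs h1 h2 h3 h4 hc
    have a1 := A.lam u hc s hs
    have a2 := A.lam u hc (g s) (A.cg s hs)
    rw [hg] at a2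
    have b1 := E.2 u hc s hs hs h1 h2
    have b2 := E.2 u hc (g s) (A.cg s hs) (A.cg s hs) h3 h4
    omega
  by_cases hc : u ∈ cx
  · have m := hmix u s hu hs h1 h2 h3 h4 hc
    by_cases hc' : s ∈ cx
    · have m' := hmix s u hs hu h1.symm (fun h => h3 h.symm) (fun h => h2 h.symm)
        (fun h => h4 h.symm) hc'
      omega
    · have := A.nc s hs hc' hgs
      omega
  · by_cases hc' : s ∈ cx
    · have m' := hmix s u hs hu h1.symm (fun h => h3 h.symm) (fun h => h2 h.symm)
        (fun h => h4 h.symm) hc'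
      have := A.nc u hu hc hgu
      omega
    · have hn1 := A.nc s hs hc' hgs
      have hn2 := A.nc u hu hc hgu
      have gc : g u ∉ cx := fun h => hc (by simpa [hg] using A.cgc _ h)
      have gc' : g s ∉ cx := fun h => hc' (by simpa [hg] using A.cgc _ h)
      have Q : ∀ p q, p ∈ T → q ∈ T → p ∉ cx → q ∉ cx → p ≠ q →
          ¬ (x (g p) = x p + 1 ∧ x (g q) = x q + 1 ∧ x p = x q) :=
        fun p q k1 k2 k3 k4 k5 k6 => k5 (A.uniq p k1 q k2 k3 k4 k6.1 k6.2.1 k6.2.2)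
      have q1 := Q s u hs hu hc' hc h1
      have q2 := Q s (g u) hs (A.cg u hu) hc' gc h2
      have q3 := Q (g s) u (A.cg s hs) hu gc' hc h3
      have q4 := Q (g s) (g u) (A.cg s hs) (A.cg u hu) gc' gc h4
      simp only [hg] at q1 q2 q3 q4
      clear Q hmix
      have hx : (x u ≤ x s ∧ x u ≤ x (g s) ∧ x (g u) ≤ x s ∧ x (g u) ≤ x (g s)) ∨
          (x s ≤ x u ∧ x s ≤ x (g u) ∧ x (g s) ≤ x u ∧ x (g s) ≤ x (g u)) := by
        rcases hn1 with hn1 | hn1 <;> rcases hn2 with hn2 | hn2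
        · have : x s ≠ x u := fun h => q1 ⟨hn1, hn2, h⟩
          clear q1 q2 q3 q4
          omega
        · have : x s ≠ x (g u) := fun h => q2 ⟨hn1, hn2, h⟩
          clear q1 q2 q3 q4
          omega
        · have : x (g s) ≠ x u := fun h => q3 ⟨hn1, hn2, h⟩
          clear q1 q2 q3 q4
          omega
        · have : x (g s) ≠ x (g u) := fun h => q4 ⟨hn1, hn2, h⟩
          clear q1 q2 q3 q4
          omega
      exact hx.elim Or.inl fun h => Or.inr (Or.inl h)

lemma stt_geo {f h g : V → V} {T : Finset V} {x y : V → ℕ} {kx ky : ℕ} {cx cy : Set V}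
    (hg : ∀ v, g (g v) = v)
    (H : Stt f h g T T x y kx ky cx cy) (φ ψ : ℕ → ℤ) (hφ : StrictMono φ) (hψ : StrictMono ψ) :
    Geo f h g T (fun v => φ (x v)) (fun v => ψ (y v)) := by
  have hcore := core_g3 hg H
  obtain ⟨⟨A, B⟩, E, F⟩ := H
  constructor
  · exact A.cf
  · exact B.cf
  · exact A.cg
  · intro u hu v hv hh
    exact A.inj u hu v hv (hφ.injective hh)
  · intro v hv; simp only [A.xf v hv]
  · intro u hu v hv hh
    exact B.inj u hu v hv (hψ.injective hh)
  · intro v hv; simp only [B.xf v hv]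
  · intro u hu s hs
    simp only [hφ.lt_iff_lt, hψ.le_iff_le]
    intro h1 h2
    by_cases hc : u ∈ cx
    · refine E.2 u hc s hs hs ?_ ?_ (by omega) (by omega)
      · rintro rfl; omega
      · rintro rfl; omega
    · have := A.nc u hu hc (fun h => by rw [h] at h2; omega)
      omega
  · intro u hu s hs
    simp only [hψ.lt_iff_lt, hφ.le_iff_le]
    intro h1 h2
    by_cases hc : u ∈ cy
    · refine F.2 u hc s hs hs ?_ ?_ (by omega) (by omega)
      · rintro rfl; omega
      · rintro rfl; omega
    · have := B.nc u hu hc (fun h => by rw [h] at h2; omega)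
      omega
  · intro u hu s hs
    simp only [hψ.le_iff_le, hφ.le_iff_le]
    exact hcore u s hu hs

/-- The point `(a, b)` lies on the segment of `u` and `v`. -/
def OnSeg (X Y : V → ℤ) (u v : V) (a b : ℝ) : Prop :=
  ∃ t : ℝ, 0 ≤ t ∧ t ≤ 1 ∧ a = (1 - t) * X u + t * X v ∧ b = (1 - t) * Y u + t * Y v

lemma OnSeg.symm {X Y : V → ℤ} {u v : V} {a b : ℝ} (H : OnSeg X Y u v a b) :
    OnSeg X Y v u a b := by
  obtain ⟨t, h1, h2, h3, h4⟩ := H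
  exact ⟨1 - t, by linarith, by linarith, by rw [h3]; ring, by rw [h4]; ring⟩

lemma OnSeg.swap {X Y : V → ℤ} {u v : V} {a b : ℝ} (H : OnSeg X Y u v a b) :
    OnSeg Y X u v b a := by
  obtain ⟨t, h1, h2, h3, h4⟩ := H
  exact ⟨t, h1, h2, h4, h3⟩

/-- Trichotomy for a point of a segment. -/
lemma OnSeg.cases {X Y : V → ℤ} {u v : V} {a b : ℝ} (H : OnSeg X Y u v a b)
    (hx : X u ≠ X v) (hy : Y u ≠ Y v) :
    (a = X u ∧ b = Y u) ∨ (a = X v ∧ b = Y v) ∨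
    (((X u < a ∧ a < X v) ∨ (X v < a ∧ a < X u)) ∧
      ((Y u < b ∧ b < Y v) ∨ (Y v < b ∧ b < Y u))) := by
  obtain ⟨t, h1, h2, h3, h4⟩ := H
  rcases h1.eq_or_lt with h1 | h1
  · left; subst h1; constructor <;> linarith
  rcases h2.eq_or_lt with h2 | h2
  · right; left; subst h2; constructor <;> linarith
  right; right
  constructor
  · rcases lt_or_gt_of_ne hx with h | h
    · have : (X u : ℝ) < X v := by exact_mod_cast h
      left; constructor <;> nlinarith
    · have : (X v : ℝ) < X u := by exact_mod_cast h
      right; constructor <;> nlinarith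
  · rcases lt_or_gt_of_ne hy with h | h
    · have : (Y u : ℝ) < Y v := by exact_mod_cast h
      left; constructor <;> nlinarith
    · have : (Y v : ℝ) < Y u := by exact_mod_cast h
      right; constructor <;> nlinarith

/-- Edges of the three matchings. -/
def Edg (f h g : V → V) (u v : V) : Prop := u ≠ v ∧ (v = f u ∨ v = h u ∨ v = g u)

/-- RAC drawing of the edge relation restricted to `S`. -/
structure RACOn (E : V → V → Prop) (S : Finset V) (X Y : V → ℤ) : Prop where
  inj : ∀ u ∈ S, ∀ v ∈ S, X u = X v → Y u = Y v → u = v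
  off : ∀ u ∈ S, ∀ v ∈ S, ∀ w ∈ S, E u v → w ≠ u → w ≠ v → ¬ OnSeg X Y u v (X w) (Y w)
  rac : ∀ u ∈ S, ∀ v ∈ S, ∀ u' ∈ S, ∀ v' ∈ S, E u v → E u' v' → u ≠ u' → u ≠ v' → v ≠ u' →
    v ≠ v' → ∀ a b, OnSeg X Y u v a b → OnSeg X Y u' v' a b →
    (X v - X u) * (X v' - X u') + (Y v - Y u) * (Y v' - Y u') = 0

lemma Geo.swap {f h g : V → V} {S : Finset V} {X Y : V → ℤ} (H : Geo f h g S X Y) :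
    Geo h f g S Y X where
  cf := H.ch
  ch := H.cf
  cg := H.cg
  e1 := H.e2
  e1f := H.e2h
  e2 := H.e1
  e2h := H.e1f
  g1 := H.g2
  g2 := H.g1
  g3 := by
    intro u hu s hs a b c d
    have := H.g3 u hu s hs a b c d
    tauto

/-- Matchings are disjoint involutions. -/
structure Inv3 (f h g : V → V) : Prop where
  ff : ∀ v, f (f v) = v
  hh : ∀ v, h (h v) = v
  gg : ∀ v, g (g v) = v
  fh : ∀ v, f v = h v → f v = v
  fg : ∀ v, f v = g v → f v = v
  hg : ∀ v, h v = g v → h v = v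

lemma Inv3.swap {f h g : V → V} (I : Inv3 f h g) : Inv3 h f g where
  ff := I.hh
  hh := I.ff
  gg := I.gg
  fh := fun v hv => by rw [hv]; exact I.fh v hv.symm
  fg := I.hg
  hg := I.fg

lemma Geo.inj {f h g : V → V} (I : Inv3 f h g) {S : Finset V} {X Y : V → ℤ}
    (H : Geo f h g S X Y) : ∀ u ∈ S, ∀ v ∈ S, X u = X v → Y u = Y v → u = v := by
  intro u hu v hv h1 h2
  rcases H.e1 u hu v hv h1 with h | h
  · exact h
  rcases H.e2 u hu v hv h2 with h' | h'
  · exact h'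
  rw [h]; exact I.fh v (h.symm.trans h')

lemma Geo.gx {f h g : V → V} (I : Inv3 f h g) {S : Finset V} {X Y : V → ℤ}
    (H : Geo f h g S X Y) (u : V) (hu : u ∈ S) (hn : u ≠ g u) : X u ≠ X (g u) := by
  intro h
  rcases H.e1 _ hu _ (H.cg u hu) h with h | h
  · exact hn h
  · have h' : f u = g u := by rw [← I.ff (g u), ← h]
    exact hn (by rw [← h']; exact (I.fg u h').symm)

lemma geo_sep {X Y : V → ℤ} {u v s t : V} {a b : ℝ} (h1 : OnSeg X Y u v a b)
    (h2 : OnSeg X Y s t a b) (hx : X u ≠ X v) (hx' : X s ≠ X t) (hy : Y u ≠ Y v) (hy' : Y s ≠ Y t)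
    (hs : X u ≤ X s ∧ X u ≤ X t ∧ X v ≤ X s ∧ X v ≤ X t) :
    ((X u = X s ∧ Y u = Y s) ∨ (X u = X t ∧ Y u = Y t)) ∨
    ((X v = X s ∧ Y v = Y s) ∨ (X v = X t ∧ Y v = Y t)) := by
  have hs' : (X u : ℝ) ≤ X s ∧ (X u : ℝ) ≤ X t ∧ (X v : ℝ) ≤ X s ∧ (X v : ℝ) ≤ X t := by
    exact_mod_cast hs
  obtain ⟨c1, c2, c3, c4⟩ := hs'
  have fin : ∀ p q : V, a = X p ∧ b = Y p → a = X q ∧ b = Y q → X p = X q ∧ Y p = Y q := by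
    rintro p q ⟨a1, a2⟩ ⟨a3, a4⟩
    constructor
    · exact_mod_cast a1.symm.trans a3
    · exact_mod_cast a2.symm.trans a4
  rcases h1.cases hx hy with d | d | ⟨d, _⟩ <;> rcases h2.cases hx' hy' with e | e | ⟨e, _⟩
  · exact Or.inl (Or.inl (fin _ _ d e))
  · exact Or.inl (Or.inr (fin _ _ d e))
  · exfalso; rcases e with e | e <;> linarith [d.1]
  · exact Or.inr (Or.inl (fin _ _ d e))
  · exact Or.inr (Or.inr (fin _ _ d e))
  · exfalso; rcases e with e | e <;> linarith [d.1]
  · exfalso; rcases d with d | d <;> linarith [e.1]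
  · exfalso; rcases d with d | d <;> linarith [e.1]
  · exfalso; rcases d with d | d <;> rcases e with e | e <;> linarith

lemma geo_fg {f h g : V → V} (I : Inv3 f h g) {S : Finset V} {X Y : V → ℤ}
    (H : Geo f h g S X Y) (u s : V) (hu : u ∈ S) (hs : s ∈ S) (hn' : s ≠ g s)
    (h1 : u ≠ s) (h2 : u ≠ g s) (h3 : f u ≠ s) (h4 : f u ≠ g s) (a b : ℝ)
    (c1 : OnSeg X Y u (f u) a b) (c2 : OnSeg X Y s (g s) a b) : False := by
  have hx := H.gx I s hs hn'
  have hy := H.swap.gx I.swap s hs hn'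
  obtain ⟨t, t0, t1, t2, t3⟩ := c1
  rw [H.e1f u hu] at t2
  have ha : a = X u := by rw [t2]; ring
  have hne : ∀ z ∈ S, u ≠ z → f u ≠ z → X u ≠ X z := by
    intro z hz k1 k2 k3
    rcases H.e1 u hu z hz k3 with k | k
    · exact k1 k
    · exact k2 (by rw [k, I.ff])
  have hgs := H.cg s hs
  have hb : (Y u ≤ b ∨ Y (f u) ≤ b) := by
    rcases le_total (Y u : ℝ) (Y (f u)) with k | k
    · left; nlinarith
    · right; nlinarith
  have key : ∀ z z' : V, z ∈ S → z' ∈ S → z' = g z → X z < a → a < X z' → Y z ≤ b ∧ Y z' ≤ b := by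
    intro z z' hz hz' e k1 k2
    subst e
    rw [ha] at k1 k2
    have k1' : X z < X u := by exact_mod_cast k1
    have k2' : X u < X (g z) := by exact_mod_cast k2
    have r1 := H.g1 z hz u hu k1' k2'
    have r2 := H.g1 z hz (f u) (H.cf u hu) (by rw [H.e1f u hu]; exact k1')
      (by rw [H.e1f u hu]; exact k2')
    have r1a : (Y z : ℝ) ≤ Y u := by exact_mod_cast r1.1
    have r1b : (Y (g z) : ℝ) ≤ Y u := by exact_mod_cast r1.2
    have r2a : (Y z : ℝ) ≤ Y (f u) := by exact_mod_cast r2.1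
    have r2b : (Y (g z) : ℝ) ≤ Y (f u) := by exact_mod_cast r2.2
    constructor <;> rcases hb with hb | hb <;> linarith
  rcases c2.cases hx hy with d | d | ⟨d, e⟩
  · exact hne s hs h1 h3 (by exact_mod_cast ha.symm.trans d.1)
  · exact hne _ hgs h2 h4 (by exact_mod_cast ha.symm.trans d.1)
  · rcases d with d | d
    · have := key s (g s) hs hgs rfl d.1 d.2
      rcases e with e | e <;> linarith [this.1, this.2]
    · have := key (g s) s hgs hs (I.gg s).symm d.1 d.2
      rcases e with e | e <;> linarith [this.1, this.2]

lemma geo_ff {f h g : V → V} (I : Inv3 f h g) {S : Finset V} {X Y : V → ℤ}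
    (H : Geo f h g S X Y) (u s : V) (hu : u ∈ S) (hs : s ∈ S)
    (h1 : u ≠ s) (h2 : u ≠ f s) (a b : ℝ)
    (c1 : OnSeg X Y u (f u) a b) (c2 : OnSeg X Y s (f s) a b) : False := by
  obtain ⟨t, t0, t1, t2, t3⟩ := c1
  obtain ⟨r, r0, r1, r2, r3⟩ := c2
  rw [H.e1f u hu] at t2
  rw [H.e1f s hs] at r2
  have : (X u : ℝ) = X s := by linarith
  rcases H.e1 u hu s hs (by exact_mod_cast this) with k | k
  · exact h1 k
  · exact h2 k

lemma geo_gg {f h g : V → V} (I : Inv3 f h g) {S : Finset V} {X Y : V → ℤ}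
    (H : Geo f h g S X Y) (u s : V) (hu : u ∈ S) (hs : s ∈ S) (hn : u ≠ g u) (hn' : s ≠ g s)
    (h1 : u ≠ s) (h2 : u ≠ g s) (h3 : g u ≠ s) (h4 : g u ≠ g s) (a b : ℝ)
    (c1 : OnSeg X Y u (g u) a b) (c2 : OnSeg X Y s (g s) a b) : False := by
  have hx := H.gx I s hs hn'
  have hy := H.swap.gx I.swap s hs hn'
  have hx' := H.gx I u hu hn
  have hy' := H.swap.gx I.swap u hu hn
  have i := H.inj I
  have hgs := H.cg s hs
  have hgu := H.cg u hu
  rcases H.g3 u hu s hs hn.symm hn'.symm h1.symm h3.symm with k | k | k | k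
  · rcases geo_sep c1 c2 hx' hx hy' hy k with (d | d) | (d | d)
    · exact h1 (i _ hu _ hs d.1 d.2)
    · exact h2 (i _ hu _ hgs d.1 d.2)
    · exact h3 (i _ hgu _ hs d.1 d.2)
    · exact h4 (i _ hgu _ hgs d.1 d.2)
  · rcases geo_sep c2 c1 hx hx' hy hy' k with (d | d) | (d | d)
    · exact h1 (i _ hs _ hu d.1 d.2).symm
    · exact h3 (i _ hs _ hgu d.1 d.2).symm
    · exact h2 (i _ hgs _ hu d.1 d.2).symm
    · exact h4 (i _ hgs _ hgu d.1 d.2).symm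
  · rcases geo_sep c1.swap c2.swap hy' hy hx' hx k with (d | d) | (d | d)
    · exact h1 (i _ hu _ hs d.2 d.1)
    · exact h2 (i _ hu _ hgs d.2 d.1)
    · exact h3 (i _ hgu _ hs d.2 d.1)
    · exact h4 (i _ hgu _ hgs d.2 d.1)
  · rcases geo_sep c2.swap c1.swap hy hy' hx hx' k with (d | d) | (d | d)
    · exact h1 (i _ hs _ hu d.2 d.1).symm
    · exact h3 (i _ hs _ hgu d.2 d.1).symm
    · exact h2 (i _ hgs _ hu d.2 d.1).symm
    · exact h4 (i _ hgs _ hgu d.2 d.1).symm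

lemma geo_rac {f h g : V → V} (I : Inv3 f h g) {S : Finset V} {X Y : V → ℤ}
    (H : Geo f h g S X Y) : RACOn (Edg f h g) S X Y := by
  refine ⟨H.inj I, ?_, ?_⟩
  · rintro u hu v hv w hw ⟨hn, rfl | rfl | rfl⟩ h1 h2 hseg
    · obtain ⟨t, t0, t1, t2, t3⟩ := hseg
      rw [H.e1f u hu] at t2
      have : (X w : ℝ) = X u := by linarith
      rcases H.e1 w hw u hu (by exact_mod_cast this) with k | k
      · exact h1 k
      · exact h2 k
    · obtain ⟨t, t0, t1, t2, t3⟩ := hseg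
      rw [H.e2h u hu] at t3
      have : (Y w : ℝ) = Y u := by linarith
      rcases H.e2 w hw u hu (by exact_mod_cast this) with k | k
      · exact h1 k
      · exact h2 k
    · have hx := H.gx I u hu hn
      have hy := H.swap.gx I.swap u hu hn
      rcases hseg.cases hx hy with d | d | ⟨d, e⟩
      · exact h1 (H.inj I w hw u hu (by exact_mod_cast d.1) (by exact_mod_cast d.2))
      · exact h2 (H.inj I w hw _ hv (by exact_mod_cast d.1) (by exact_mod_cast d.2))
      · norm_cast at d e
        have k1 := H.g1 u hu w hw
        have k2 := H.g1 _ hv w hw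
        rw [I.gg] at k2
        omega
  · rintro u hu v hv s hs t ht ⟨hn, e⟩ ⟨hn', e'⟩ h1 h2 h3 h4 a b c1 c2
    rcases e with rfl | rfl | rfl <;> rcases e' with rfl | rfl | rfl
    · exact (geo_ff I H u s hu hs h1 h2 a b c1 c2).elim
    · rw [H.e1f u hu, H.e2h s hs]; ring
    · exact (geo_fg I H u s hu hs hn' h1 h2 h3 h4 a b c1 c2).elim
    · rw [H.e2h u hu, H.e1f s hs]; ring
    · exact (geo_ff I.swap H.swap u s hu hs h1 h2 b a c1.swap c2.swap).elim
    · exact (geo_fg I.swap H.swap u s hu hs hn' h1 h2 h3 h4 b a c1.swap c2.swap).elim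
    · exact (geo_fg I H s u hs hu hn h1.symm h3.symm h2.symm h4.symm a b c2 c1).elim
    · exact (geo_fg I.swap H.swap s u hs hu hn h1.symm h3.symm h2.symm h4.symm b a
        c2.swap c1.swap).elim
    · exact (geo_gg I H u s hu hs hn hn' h1 h2 h3 h4 a b c1 c2).elim

end Geom

section Draw
set_option linter.unusedSectionVars false
variable {V : Type} [Fintype V]

lemma RACOn.congr {E E' : V → V → Prop} {S : Finset V} {X Y X' Y' : V → ℤ}
    (H : RACOn E S X Y) (hE : ∀ u ∈ S, ∀ v ∈ S, E' u v → E u v)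
    (hX : ∀ v ∈ S, X' v = X v) (hY : ∀ v ∈ S, Y' v = Y v) : RACOn E' S X' Y' := by
  have hs : ∀ u ∈ S, ∀ v ∈ S, ∀ a b, OnSeg X' Y' u v a b → OnSeg X Y u v a b := by
    intro u hu v hv a b
    simp only [OnSeg, hX u hu, hX v hv, hY u hu, hY v hv]
    exact id
  refine ⟨?_, ?_, ?_⟩
  · intro u hu v hv h1 h2
    rw [hX u hu, hX v hv] at h1
    rw [hY u hu, hY v hv] at h2
    exact H.inj u hu v hv h1 h2
  · intro u hu v hv w hw e h1 h2 hseg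
    have := hs u hu v hv _ _ hseg
    rw [hX w hw, hY w hw] at this
    exact H.off u hu v hv w hw (hE u hu v hv e) h1 h2 this
  · intro u hu v hv u' hu' v' hv' e e' h1 h2 h3 h4 a b c1 c2
    rw [hX u hu, hX v hv, hY u hu, hY v hv, hX _ hu', hX _ hv', hY _ hu', hY _ hv']
    exact H.rac u hu v hv u' hu' v' hv' (hE _ hu _ hv e) (hE _ hu' _ hv' e') h1 h2 h3 h4 a b
      (hs _ hu _ hv _ _ c1) (hs _ hu' _ hv' _ _ c2)

lemma OnSeg.shift {X Y : V → ℤ} {c d : ℤ} {u v : V} {a b : ℝ}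
    (H : OnSeg (fun v => X v + c) (fun v => Y v + d) u v a b) :
    OnSeg X Y u v (a - c) (b - d) := by
  obtain ⟨t, h1, h2, h3, h4⟩ := H
  push_cast at h3 h4
  exact ⟨t, h1, h2, by rw [h3]; ring, by rw [h4]; ring⟩

lemma RACOn.shift {E : V → V → Prop} {S : Finset V} {X Y : V → ℤ}
    (H : RACOn E S X Y) (c d : ℤ) : RACOn E S (fun v => X v + c) (fun v => Y v + d) := by
  refine ⟨?_, ?_, ?_⟩
  · intro u hu v hv h1 h2
    exact H.inj u hu v hv (by simpa using h1) (by simpa using h2)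
  · intro u hu v hv w hw e h1 h2 hseg
    have := hseg.shift
    push_cast at this
    simp only [add_sub_cancel_right] at this
    exact H.off u hu v hv w hw e h1 h2 this
  · intro u hu v hv u' hu' v' hv' e e' h1 h2 h3 h4 a b c1 c2
    have := H.rac u hu v hv u' hu' v' hv' e e' h1 h2 h3 h4 _ _ c1.shift c2.shift
    simp only [add_sub_add_right_eq_sub]
    exact this

lemma RACOn.swap {E : V → V → Prop} {S : Finset V} {X Y : V → ℤ}
    (H : RACOn E S X Y) : RACOn E S Y X := by
  refine ⟨?_, ?_, ?_⟩
  · intro u hu v hv h1 h2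
    exact H.inj u hu v hv h2 h1
  · intro u hu v hv w hw e h1 h2 hseg
    exact H.off u hu v hv w hw e h1 h2 hseg.swap
  · intro u hu v hv u' hu' v' hv' e e' h1 h2 h3 h4 a b c1 c2
    have := H.rac u hu v hv u' hu' v' hv' e e' h1 h2 h3 h4 _ _ c1.swap c2.swap
    linarith

/-- A half-plane containing both ends contains the segment. -/
lemma OnSeg.le {X Y : V → ℤ} {u v : V} {a b : ℝ} (H : OnSeg X Y u v a b) (α β c : ℤ)
    (hu : α * X u + β * Y u ≤ c) (hv : α * X v + β * Y v ≤ c) : α * a + β * b ≤ c := by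
  obtain ⟨t, h1, h2, h3, h4⟩ := H
  have hu' : (α : ℝ) * X u + β * Y u ≤ c := by exact_mod_cast hu
  have hv' : (α : ℝ) * X v + β * Y v ≤ c := by exact_mod_cast hv
  rw [h3, h4]
  nlinarith [mul_le_mul_of_nonneg_left hu' (by linarith : 0 ≤ 1 - t),
    mul_le_mul_of_nonneg_left hv' h1]

lemma OnSeg.gt {X Y : V → ℤ} {u v : V} {a b : ℝ} (H : OnSeg X Y u v a b) (α β c : ℤ)
    (hu : c < α * X u + β * Y u) (hv : c < α * X v + β * Y v) : (c : ℝ) < α * a + β * b := by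
  have := H.le (-α) (-β) (-c - 1) (by linarith) (by linarith)
  push_cast at this
  linarith

/-- The edge from `b` to `n` causes no conflict. -/
def Okay (E : V → V → Prop) (S : Finset V) (X Y : V → ℤ) (b n : V) : Prop :=
  (∀ w ∈ S, w ≠ n → ¬ OnSeg X Y b n (X w) (Y w)) ∧
  ∀ u ∈ S, ∀ v ∈ S, E u v → u ≠ n → v ≠ n → ∀ p q, OnSeg X Y b n p q → OnSeg X Y u v p q →
    (X n - X b) * (X v - X u) + (Y n - Y b) * (Y v - Y u) = 0

lemma okay_sep {E : V → V → Prop} {S : Finset V} {X Y : V → ℤ} {b n : V} (α β c : ℤ)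
    (hb : α * X b + β * Y b ≤ c) (hn : α * X n + β * Y n ≤ c)
    (hS : ∀ v ∈ S, v ≠ n → c < α * X v + β * Y v) : Okay E S X Y b n := by
  refine ⟨?_, ?_⟩
  · intro w hw hwn hseg
    have h1 := hseg.le α β c hb hn
    have h2 := hS w hw hwn
    norm_cast at h1
    omega
  · intro u hu v hv _ h1 h2 p q s1 s2
    have h3 := s1.le α β c hb hn
    have h4 := s2.gt α β c (hS u hu h1) (hS v hv h2)
    linarith

lemma rac_extend {E E' : V → V → Prop} {T : Finset V} {X Y : V → ℤ} {b : V}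
    (hs : ∀ u v, E u v → E v u) (hir : ∀ u v, E u v → u ≠ v)
    (H : RACOn E' (T.erase b) X Y)
    (hE : ∀ u ∈ T.erase b, ∀ v ∈ T.erase b, E u v → E' u v)
    (hb : ∀ v ∈ T.erase b, ¬ (X v = X b ∧ Y v = Y b))
    (ho : ∀ u ∈ T.erase b, ∀ v ∈ T.erase b, E' u v → ¬ OnSeg X Y u v (X b) (Y b))
    (hn : ∀ n, E b n → Okay E' (T.erase b) X Y b n) : RACOn E T X Y := by
  have hm : ∀ v ∈ T, v = b ∨ v ∈ T.erase b := by
    intro v hv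
    by_cases h : v = b
    · exact Or.inl h
    · exact Or.inr (Finset.mem_erase.2 ⟨h, hv⟩)
  refine ⟨?_, ?_, ?_⟩
  · intro u hu v hv h1 h2
    rcases hm u hu with rfl | hu' <;> rcases hm v hv with rfl | hv'
    · rfl
    · exact (hb v hv' ⟨h1.symm, h2.symm⟩).elim
    · exact (hb u hu' ⟨h1, h2⟩).elim
    · exact H.inj u hu' v hv' h1 h2
  · intro u hu v hv w hw e h1 h2 hseg
    rcases hm u hu with rfl | hu'
    · rcases hm w hw with rfl | hw'
      · exact h1 rfl
      · exact (hn v e).1 w hw' h2 hseg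
    · rcases hm v hv with rfl | hv'
      · rcases hm w hw with rfl | hw'
        · exact h2 rfl
        · exact (hn u (hs _ _ e)).1 w hw' h1 hseg.symm
      · rcases hm w hw with rfl | hw'
        · exact ho u hu' v hv' (hE u hu' v hv' e) hseg
        · exact H.off u hu' v hv' w hw' (hE u hu' v hv' e) h1 h2 hseg
  · have key : ∀ n ∈ T, ∀ u ∈ T, ∀ v ∈ T, E b n → E u v → b ≠ u → b ≠ v → n ≠ u → n ≠ v →
        ∀ p q, OnSeg X Y b n p q → OnSeg X Y u v p q →
        (X n - X b) * (X v - X u) + (Y n - Y b) * (Y v - Y u) = 0 := by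
      intro n _ u hu v hv e e' h1 h2 h3 h4 p q c1 c2
      have hu' : u ∈ T.erase b := Finset.mem_erase.2 ⟨h1.symm, hu⟩
      have hv' : v ∈ T.erase b := Finset.mem_erase.2 ⟨h2.symm, hv⟩
      exact (hn n e).2 u hu' v hv' (hE u hu' v hv' e') h3.symm h4.symm p q c1 c2
    intro u hu v hv u' hu' v' hv' e e' h1 h2 h3 h4 p q c1 c2
    by_cases k1 : u = b
    · subst k1
      exact key v hv u' hu' v' hv' e e' h1 h2 h3 h4 p q c1 c2
    by_cases k2 : v = b
    · subst k2
      have := key u hu u' hu' v' hv' (hs _ _ e) e' h3 h4 h1 h2 p q c1.symm c2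
      linarith
    by_cases k3 : u' = b
    · subst k3
      have := key v' hv' u hu v hv e' e h1.symm h3.symm h2.symm h4.symm p q c2 c1
      linarith
    by_cases k4 : v' = b
    · subst k4
      have := key u' hu' u hu v hv (hs _ _ e') e h2.symm h4.symm h1.symm h3.symm p q c2.symm c1
      linarith
    have m : ∀ z ∈ T, z ≠ b → z ∈ T.erase b := fun z hz hzb => Finset.mem_erase.2 ⟨hzb, hz⟩
    exact H.rac u (m u hu k1) v (m v hv k2) u' (m _ hu' k3) v' (m _ hv' k4)
      (hE _ (m u hu k1) _ (m v hv k2) e) (hE _ (m _ hu' k3) _ (m _ hv' k4) e') h1 h2 h3 h4 p q c1 c2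

/-- The drawing fits in the square of side `2 |T|`. -/
def Drawn (E : V → V → Prop) (T : Finset V) : Prop :=
  ∃ X Y : V → ℤ, (∀ v ∈ T, 0 ≤ X v ∧ X v < 2 * T.card ∧ 0 ≤ Y v ∧ Y v < 2 * T.card) ∧
    RACOn E T X Y

lemma Edg.symm {f h g : V → V} (I : Inv3 f h g) {u v : V} (H : Edg f h g u v) :
    Edg f h g v u := by
  obtain ⟨h1, h2⟩ := H
  refine ⟨h1.symm, ?_⟩
  rcases h2 with rfl | rfl | rfl
  · left; rw [I.ff]
  · right; left; rw [I.hh]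
  · right; right; rw [I.gg]

lemma Edg.swap {f h g : V → V} {u v : V} (H : Edg f h g u v) : Edg h f g u v := by
  obtain ⟨h1, h2⟩ := H
  exact ⟨h1, by tauto⟩

lemma draw_noncubic {f h g : V → V} (I : Inv3 f h g) (T : Finset V)
    (hT : Clo3 f h g (T : Set V))
    (hmin : ∀ P : Set V, Clo3 f h g P → (∃ v ∈ T, v ∈ P) → (T : Set V) ⊆ P)
    (a : V) (haT : a ∈ T) (hfix : f a = a ∨ g a = a) : Drawn (Edg f h g) T := by
  obtain ⟨C, x0, k, z, h1, h2, h3, h4, h5, h6, h7, h8, h9⟩ :=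
    stt_path I.ff I.gg (stt_empty f h g) a (by simp) hfix
  have hC : ∅ ∪ C ⊆ T := by
    intro v hv
    rw [Finset.empty_union] at hv
    exact h3 v hv (T : Set V) (fun u hu => ⟨(hT u hu).1, (hT u hu).2.2⟩) haT
  obtain ⟨x, y, kx, ky, cx, cy, H, -, -⟩ := machine I.ff I.hh I.gg T hT _ h8 hC (by simp)
    (fun P hP hX _ => hmin P hP ⟨a, haT, hX (by simp [h2])⟩) le_rfl
  have hG := stt_geo I.gg H (fun n => (n : ℤ)) (fun n => (n : ℤ))
    Int.natCast_strictMono Int.natCast_strictMono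
  refine ⟨_, _, ?_, geo_rac I hG⟩
  intro v hv
  have b1 := H.1.1.card
  have b2 := H.1.2.card
  have b3 := Finset.card_filter_le T (fun v => f v = v)
  have b4 := Finset.card_filter_le T (fun v => h v = v)
  have b5 := H.1.1.lt v hv
  have b6 := H.1.2.lt v hv
  omega

/-- Remove the vertex `b` from a matching. -/
def rem (b : V) (m : V → V) (v : V) : V := if v = b ∨ m v = b then v else m v

lemma rem_cases (b : V) (m : V → V) (v : V) : rem b m v = v ∨ rem b m v = m v := by
  unfold rem
  split_ifs <;> simp

lemma rem_inv {b : V} {m : V → V} (hm : ∀ v, m (m v) = v) (v : V) :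
    rem b m (rem b m v) = v := by
  by_cases h : v = b ∨ m v = b
  · simp only [rem, h, if_true]
  · push Not at h
    simp [rem, h.1, h.2, hm]

lemma rem_disj {b : V} {m m' : V → V} (h : ∀ v, m v = m' v → m v = v) (v : V)
    (hv : rem b m v = rem b m' v) : rem b m v = v := by
  rcases rem_cases b m v with h1 | h1
  · exact h1
  rcases rem_cases b m' v with h2 | h2
  · rw [hv, h2]
  · rw [h1]; exact h v (by rw [← h1, hv, h2])

lemma Inv3.rem {f h g : V → V} (I : Inv3 f h g) (b : V) :
    Inv3 (rem b f) (rem b h) (rem b g) where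
  ff := rem_inv I.ff
  hh := rem_inv I.hh
  gg := rem_inv I.gg
  fh := rem_disj I.fh
  fg := rem_disj I.fg
  hg := rem_disj I.hg

lemma rem_mate {b : V} {m : V → V} (hm : ∀ v, m (m v) = v) : rem b m (m b) = m b := by
  simp [rem, hm]

lemma rem_fix {b v : V} {m : V → V} (hm : ∀ v, m (m v) = v) (hv : v ≠ b) (hf : m v ≠ v)
    (h : rem b m v = v) : v = m b := by
  unfold rem at h
  split_ifs at h with h1
  · rcases h1 with h1 | h1
    · exact absurd h1 hv
    · rw [← h1, hm]
  · exact absurd h hf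

lemma rem_mem {b v : V} {m : V → V} {T : Finset V} (h : m v ∈ T) (hv : v ∈ T.erase b) :
    rem b m v ∈ T.erase b := by
  unfold rem
  split_ifs with h1
  · exact hv
  · push Not at h1
    exact Finset.mem_erase.2 ⟨h1.2, h⟩

/-- What we know about one coordinate after the construction without `b`. -/
structure Half (f g : V → V) (T C : Finset V) (x : V → ℕ) (k0 k : ℕ) (c : Set V) (a w : V) :
    Prop where
  sub : ∀ v ∈ C, v ∈ T
  clf : ∀ v ∈ C, f v ∈ C
  clg : ∀ v ∈ C, g v ∈ C
  aC : a ∈ C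
  wC : w ∈ C
  xa : x a = 0
  xw : x w + 1 = k0
  inn : ∀ v ∈ C, x v < k0
  out : ∀ v ∈ T, v ∉ C → k0 ≤ x v
  cc : ∀ u ∈ c, k0 ≤ x u
  cl : ∀ v ∈ C, v ∈ cls f g a
  un : ∀ v ∈ T, x v = 0 → v = a
  kk : k0 ≤ k
  k2 : 2 ≤ k0
  card : 2 * k ≤ T.card + 1

lemma path_end {f g : V → V} (hf : ∀ v, f (f v) = v) (hg : ∀ v, g (g v) = v)
    (hfg : ∀ v, f v = g v → f v = v)
    {T : Finset V} {b : V} (hb : b ∈ T) (hcub : ∀ v ∈ T, f v ≠ v ∧ g v ≠ v)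
    {C : Finset V} {x0 : V → ℕ} {k0 : ℕ} {z : V}
    (h1 : Core (rem b f) (rem b g) C x0 k0 ∅) (h2 : f b ∈ C)
    (h4 : x0 (f b) = 0) (h5 : z ∈ C)
    (h6 : x0 z + 1 = k0) (h7 : rem b f z = z ∨ rem b g z = z)
    (hsub : ∀ v ∈ C, v ∈ T.erase b) : z = g b ∧ z ≠ f b := by
  have ha : rem b f (f b) = f b := rem_mate hf
  have hz := Finset.mem_erase.1 (hsub z h5)
  have hza : z ≠ f b := by
    rintro rfl
    have e1 := h1.cg _ h2
    have e2 := h1.lt _ e1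
    have e3 : rem b g (f b) = f b := by
      have := h1.inj _ e1 (f b) h2 (by omega)
      rw [ha] at this
      tauto
    have e4 := rem_fix hg hz.1 (hcub _ hz.2).2 e3
    exact (hcub b hb).1 (hfg b e4)
  refine ⟨?_, hza⟩
  rcases h7 with h7 | h7
  · exact absurd (rem_fix hf hz.1 (hcub _ hz.2).1 h7) hza
  · exact rem_fix hg hz.1 (hcub _ hz.2).2 h7

lemma half_mk {f g : V → V} (hf : ∀ v, f (f v) = v) (hg : ∀ v, g (g v) = v)
    (hfg : ∀ v, f v = g v → f v = v)
    {T : Finset V} {b : V} (hb : b ∈ T) (hcub : ∀ v ∈ T, f v ≠ v ∧ g v ≠ v)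
    {C : Finset V} {x0 : V → ℕ} {k0 : ℕ} {z : V} {c : Set V} {x : V → ℕ} {k : ℕ}
    (h1 : Core (rem b f) (rem b g) C x0 k0 ∅) (h2 : f b ∈ C)
    (h3 : ∀ v ∈ C, v ∈ cls (rem b f) (rem b g) (f b)) (h4 : x0 (f b) = 0) (h5 : z ∈ C)
    (h6 : x0 z + 1 = k0) (h7 : rem b f z = z ∨ rem b g z = z)
    (hx : ∀ v ∈ C, x v = x0 v) (hsub : ∀ v ∈ C, v ∈ T.erase b)
    (hout : ∀ v ∈ T.erase b, v ∉ C → k0 ≤ x v) (hcc : ∀ u ∈ c, k0 ≤ x u)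
    (H : Core (rem b f) (rem b g) (T.erase b) x k c) :
    Half (rem b f) (rem b g) (T.erase b) C x k0 k c (f b) (g b) := by
  have ha : rem b f (f b) = f b := rem_mate hf
  have hab : f b ∈ T.erase b := hsub _ h2
  have hun : ∀ v ∈ T.erase b, x v = 0 → v = f b := by
    intro v hv hx0
    have := H.inj v hv (f b) hab (by rw [hx0, hx _ h2, h4])
    rw [ha] at this
    tauto
  obtain ⟨hzw, hza⟩ := path_end hf hg hfg hb hcub h1 h2 h4 h5 h6 h7 hsub
  subst hzw
  have hxw : x (g b) ≠ 0 := fun h => hza (hun _ (hsub _ h5) h)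
  have hwk := H.lt _ (hsub _ h5)
  have e := hx _ h5
  refine ⟨hsub, h1.cf, h1.cg, h2, h5, by rw [hx _ h2, h4], by omega, ?_, hout, hcc, h3, hun,
    by omega, by omega, ?_⟩
  · intro v hv; rw [hx v hv]; exact h1.lt v hv
  · have hc := H.card
    have : ((T.erase b).filter (fun v => rem b f v = v)).card ≤ 1 := by
      rw [Finset.card_le_one]
      have : ∀ v ∈ (T.erase b).filter (fun v => rem b f v = v), v = f b := by
        intro v hv
        rw [Finset.mem_filter] at hv
        have hv' := Finset.mem_erase.1 hv.1
        exact rem_fix hf hv'.1 (hcub _ hv'.2).1 hv.2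
      intro u hu v hv
      rw [this u hu, this v hv]
    omega

lemma cubic_setup {f h g : V → V} (I : Inv3 f h g) (T : Finset V)
    (hT : Clo3 f h g (T : Set V))
    (hmin : ∀ P : Set V, Clo3 f h g P → (∃ v ∈ T, v ∈ P) → (T : Set V) ⊆ P)
    (hcub : ∀ v ∈ T, f v ≠ v ∧ h v ≠ v ∧ g v ≠ v) (b : V) (hb : b ∈ T) :
    ∃ x y kx ky cx cy C D k0 l0,
      Stt (rem b f) (rem b h) (rem b g) (T.erase b) (T.erase b) x y kx ky cx cy ∧
      Half (rem b f) (rem b g) (T.erase b) C x k0 kx cx (f b) (g b) ∧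
      Half (rem b h) (rem b g) (T.erase b) D y l0 ky cy (h b) (g b) := by
  have I' := I.rem b
  have hT' : Clo3 (rem b f) (rem b h) (rem b g) ((T.erase b : Finset V) : Set V) := by
    intro v hv
    have hvT : v ∈ T := Finset.mem_of_mem_erase hv
    exact ⟨rem_mem (hT v hvT).1 hv, rem_mem (hT v hvT).2.1 hv, rem_mem (hT v hvT).2.2 hv⟩
  have ha : f b ∈ T.erase b := Finset.mem_erase.2 ⟨(hcub b hb).1, (hT b hb).1⟩
  have hb' : h b ∈ T.erase b := Finset.mem_erase.2 ⟨(hcub b hb).2.1, (hT b hb).2.1⟩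
  obtain ⟨C, x0, k0, z, p1, p2, p3, p4, p5, p6, p7, p8, -⟩ :=
    stt_path I'.ff I'.gg (stt_empty (rem b f) (rem b h) (rem b g)) (f b) (by simp)
      (Or.inl (rem_mate I.ff))
  obtain ⟨D, y0, l0, z', q1, q2, q3, q4, q5, q6, q7, q8, -⟩ :=
    stt_path I'.hh I'.gg p8.swap (h b) (by simp) (Or.inl (rem_mate I.hh))
  have hC : ∀ v ∈ C, v ∈ T.erase b := by
    intro v hv
    exact p3 v hv _ (fun u hu => ⟨(hT' u hu).1, (hT' u hu).2.2⟩) ha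
  have hD : ∀ v ∈ D, v ∈ T.erase b := by
    intro v hv
    exact q3 v hv _ (fun u hu => ⟨(hT' u hu).2.1, (hT' u hu).2.2⟩) hb'
  have hw1 := path_end I.ff I.gg I.fg hb (fun v hv => ⟨(hcub v hv).1, (hcub v hv).2.2⟩)
    p1 p2 p4 p5 p6 p7 hC
  have hP : ∀ P : Set V, Clo3 (rem b f) (rem b h) (rem b g) P → ((∅ ∪ C : Finset V) : Set V) ⊆ P →
      ((∅ ∪ D : Finset V) : Set V) ⊆ P → ((T.erase b : Finset V) : Set V) ⊆ P := by
    intro P hP h1 h2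
    have m1 : f b ∈ P := h1 (by simp [p2])
    have m2 : h b ∈ P := h2 (by simp [q2])
    have m3 : g b ∈ P := h1 (by rw [← hw1.1]; simp [p5])
    have st : ∀ m : V → V, ∀ v, v ≠ b → rem b m v ∈ P → m v ∈ insert b P := by
      intro m v hvb hv
      unfold rem at hv
      split_ifs at hv with hc
      · rcases hc with hc | hc
        · exact absurd hc hvb
        · exact Or.inl hc
      · exact Or.inr hv
    have : (T : Set V) ⊆ insert b P := by
      refine hmin _ ?_ ⟨b, hb, Or.inl rfl⟩
      intro v hv
      by_cases hvb : v = b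
      · subst hvb
        exact ⟨Or.inr m1, Or.inr m2, Or.inr m3⟩
      · have hvP : v ∈ P := by
          rcases hv with hv | hv
          · exact absurd hv hvb
          · exact hv
        obtain ⟨s1, s2, s3⟩ := hP v hvP
        exact ⟨st f v hvb s1, st h v hvb s2, st g v hvb s3⟩
    intro v hv
    have hv' := Finset.mem_erase.1 hv
    rcases this hv'.2 with h | h
    · exact absurd h hv'.1
    · exact h
  obtain ⟨x, y, kx, ky, cx, cy, H, E1, E2⟩ := machine I'.ff I'.hh I'.gg (T.erase b) hT' _ q8.swap
    (by rw [Finset.empty_union]; exact hC) (by rw [Finset.empty_union]; exact hD) hP le_rfl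
  simp only [Finset.empty_union] at E1 E2
  refine ⟨x, y, kx, ky, cx, cy, C, D, k0, l0, H, ?_, ?_⟩
  · refine half_mk I.ff I.gg I.fg hb (fun v hv => ⟨(hcub v hv).1, (hcub v hv).2.2⟩)
      p1 p2 p3 p4 p5 p6 p7 ?_ hC ?_ ?_ H.1.1
    · intro v hv
      have := (E1.1 v hv).2
      simpa [hv] using this
    · intro v hv hv'
      have := E1.2.1 v hv hv'
      simpa using this
    · intro u hu
      have := E1.2.2 u hu
      simpa using this
  · refine half_mk I.hh I.gg I.hg hb (fun v hv => ⟨(hcub v hv).2.1, (hcub v hv).2.2⟩)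
      q1 q2 q3 q4 q5 q6 q7 ?_ hD ?_ ?_ H.1.2
    · intro v hv
      have := (E2.1 v hv).2
      simpa [hv] using this
    · intro v hv hv'
      have := E2.2.1 v hv hv'
      simpa using this
    · intro u hu
      have := E2.2.2 u hu
      simpa using this

end Draw

section Cubic
set_option linter.unusedSectionVars false
variable {V : Type} [Fintype V]

lemma edg_rem {f h g : V → V} {b u v : V} (hu : u ≠ b) (hv : v ≠ b) (H : Edg f h g u v) :
    Edg (rem b f) (rem b h) (rem b g) u v := by
  obtain ⟨h1, h2⟩ := H
  refine ⟨h1, ?_⟩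
  rcases h2 with rfl | rfl | rfl
  · left; simp [rem, hu, hv]
  · right; left; simp [rem, hu, hv]
  · right; right; simp [rem, hu, hv]

lemma drawn_of {E : V → V → Prop} {T : Finset V} {X Y : V → ℤ} (H : RACOn E T X Y) (c d : ℤ)
    (hX : ∀ v ∈ T, 0 ≤ X v + c ∧ X v + c < 2 * T.card)
    (hY : ∀ v ∈ T, 0 ≤ Y v + d ∧ Y v + d < 2 * T.card) : Drawn E T :=
  ⟨_, _, fun v hv => ⟨(hX v hv).1, (hX v hv).2, (hY v hv).1, (hY v hv).2⟩, H.shift c d⟩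

/-- Common final step of the cubic case. -/
lemma cubic_fin {f h g : V → V} (I : Inv3 f h g) (T : Finset V)
    (hcub : ∀ v ∈ T, f v ≠ v ∧ h v ≠ v ∧ g v ≠ v) (b : V) (hb : b ∈ T) (X Y : V → ℤ)
    (H : RACOn (Edg (rem b f) (rem b h) (rem b g)) (T.erase b) X Y)
    (hsep : (∀ v ∈ T.erase b, X b < X v) ∨ (∀ v ∈ T.erase b, X v < X b))
    (h1 : Okay (Edg (rem b f) (rem b h) (rem b g)) (T.erase b) X Y b (f b))
    (h2 : Okay (Edg (rem b f) (rem b h) (rem b g)) (T.erase b) X Y b (h b))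
    (h3 : Okay (Edg (rem b f) (rem b h) (rem b g)) (T.erase b) X Y b (g b)) :
    RACOn (Edg f h g) T X Y := by
  refine rac_extend (b := b) (fun u v => Edg.symm I) (fun u v e => e.1) H ?_ ?_ ?_ ?_
  · intro u hu v hv e
    exact edg_rem (Finset.mem_erase.1 hu).1 (Finset.mem_erase.1 hv).1 e
  · rintro v hv ⟨h1, h2⟩
    rcases hsep with k | k
    · have := k v hv; omega
    · have := k v hv; omega
  · intro u hu v hv _ hseg
    rcases hsep with k | k
    · have := hseg.gt 1 0 (X b) (by simpa using k u hu) (by simpa using k v hv)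
      simp at this
    · have := hseg.gt (-1) 0 (-X b) (by simpa using k u hu) (by simpa using k v hv)
      simp at this
  · rintro n ⟨_, rfl | rfl | rfl⟩
    · exact h1
    · exact h2
    · exact h3

/-- Stretching the first position. -/
def stretch (m : ℤ) (n : ℕ) : ℤ := if n = 0 then m else n

lemma stretch_mono {m : ℤ} (hm : m ≤ 0) : StrictMono (stretch m) := by
  intro a b hab
  unfold stretch
  split_ifs <;> omega

lemma draw_case1 {f h g : V → V} (I : Inv3 f h g) (T : Finset V)
    (hT : Clo3 f h g (T : Set V))
    (hmin : ∀ P : Set V, Clo3 f h g P → (∃ v ∈ T, v ∈ P) → (T : Set V) ⊆ P)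
    (hcub : ∀ v ∈ T, f v ≠ v ∧ h v ≠ v ∧ g v ≠ v) (w : V) (hw : w ∈ T)
    (hcl : h w ∉ cls f g w) : Drawn (Edg f h g) T := by
  obtain ⟨b, hbw⟩ : ∃ b, b = g w := ⟨_, rfl⟩
  have hb : b ∈ T := hbw ▸ (hT w hw).2.2
  have hgb : g b = w := by rw [hbw, I.gg]
  obtain ⟨x, y, kx, ky, cx, cy, C, D, k0, l0, H, A, B⟩ := cubic_setup I T hT hmin hcub b hb
  rw [hgb] at A B
  have hcT : (T.erase b).card + 1 = T.card := Finset.card_erase_add_one hb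
  have I' := I.rem b
  have hwT : w ∈ T.erase b := A.sub _ A.wC
  have hwb : w ≠ b := (Finset.mem_erase.1 hwT).1
  have hhwb : h w ≠ b := by
    intro e
    exact (hcub w hw).2.1 (I.hg w (by rw [e, hbw]))
  have hhwT : h w ∈ T.erase b := Finset.mem_erase.2 ⟨hhwb, (hT w hw).2.1⟩
  have hrw : rem b h w = h w := by simp [rem, hwb, hhwb]
  have hwC : h w ∉ C := by
    intro hC
    refine hcl (A.cl _ hC (cls f g w) ?_ ?_)
    · intro v hv
      have := cls_clo f g w v hv
      constructor
      · rcases rem_cases b f v with e | e <;> rw [e]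
        · exact hv
        · exact this.1
      · rcases rem_cases b g v with e | e <;> rw [e]
        · exact hv
        · exact this.2
    · have e1 := (cls_clo f g w w (cls_self f g w)).2
      rw [← hbw] at e1
      exact (cls_clo f g w b e1).1
  have hxw : x w < x (h w) := lt_of_lt_of_le (A.inn w A.wC) (A.out _ hhwT hwC)
  have hyw : 1 ≤ y w := by
    have := B.xw
    have := B.k2
    omega
  have hkx := H.1.1.lt
  have hky := H.1.2.lt
  have hφ : StrictMono (fun n : ℕ => (n : ℤ)) := Int.natCast_strictMono
  have hψ : StrictMono (stretch (-ky)) := stretch_mono (by omega)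
  have hG := stt_geo I'.gg H _ _ hφ hψ
  obtain ⟨X, hX⟩ : ∃ X : V → ℤ, X = fun v => if v = b then -(kx : ℤ) else x v := ⟨_, rfl⟩
  obtain ⟨Y, hY⟩ : ∃ Y : V → ℤ, Y = fun v => if v = b then (y w : ℤ) else stretch (-ky) (y v) :=
    ⟨_, rfl⟩
  have hXb : X b = -kx := by simp [hX]
  have hYb : Y b = y w := by simp [hY]
  have hXv : ∀ v ∈ T.erase b, X v = x v := by
    intro v hv; simp [hX, (Finset.mem_erase.1 hv).1]
  have hYv : ∀ v ∈ T.erase b, Y v = stretch (-ky) (y v) := by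
    intro v hv; simp [hY, (Finset.mem_erase.1 hv).1]
  clear hX hY
  have hYpos : ∀ v ∈ T.erase b, 1 ≤ y v → Y v = y v := by
    intro v hv h1
    rw [hYv v hv, stretch, if_neg (by omega)]
  have hYw := hYpos w hwT hyw
  have hRow : ∀ v ∈ T.erase b, Y v = Y w → v ≠ w → v = h w := by
    intro v hv e hne
    rw [hYv v hv, hYv w hwT] at e
    have := H.1.2.inj v hv w hwT (hψ.injective e)
    rw [hrw] at this
    tauto
  have hb'T := B.sub _ B.aC
  have haT := A.sub _ A.aC
  have hkw := hkx w hwT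
  have hlw := hky w hwT
  refine drawn_of (X := X) (Y := Y) (cubic_fin I T hcub b hb X Y ?_ ?_ ?_ ?_ ?_) kx ky ?_ ?_
  · exact (geo_rac I' hG).congr (fun _ _ _ _ e => e) hXv hYv
  · left
    intro v hv
    rw [hXb, hXv v hv]
    omega
  · refine okay_sep 1 0 0 ?_ ?_ ?_
    · rw [hXb]; omega
    · rw [hXv _ haT, A.xa]; simp
    · intro v hv hne
      rw [hXv v hv]
      have : x v ≠ 0 := fun e => hne (A.un v hv e)
      omega
  · have hx' := hkx _ hb'T
    refine okay_sep (ky + y w) (kx + x (h b)) ((x (h b)) * (y w) - kx * ky) ?_ ?_ ?_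
    · rw [hXb, hYb]; apply le_of_eq; ring
    · rw [hXv _ hb'T, hYv _ hb'T, B.xa, stretch, if_pos rfl]; apply le_of_eq; ring
    · intro v hv hne
      have : y v ≠ 0 := fun e => hne (B.un v hv e)
      rw [hXv v hv, hYpos v hv (by omega)]
      have q1 : (1 : ℤ) ≤ y v := by omega
      have q2 : (0 : ℤ) ≤ x v := by omega
      have q3 : (x (h b) : ℤ) < kx := by omega
      have q4 : (y w : ℤ) < ky := by omega
      have q5 : (0 : ℤ) ≤ x (h b) := by omega
      have q6 : (0 : ℤ) ≤ y w := by omega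
      have q7 : (x (h b) : ℤ) * y w ≤ kx * ky := by nlinarith
      have q8 : 0 ≤ ((ky : ℤ) + y w) * x v := by positivity
      have q9 : ((kx : ℤ) + x (h b)) * 1 ≤ (kx + x (h b)) * y v :=
        mul_le_mul_of_nonneg_left q1 (by omega)
      linarith
  · rw [hgb]
    have hpt : ∀ p q, OnSeg X Y b w p q → p ≤ X w ∧ q = Y w := by
      intro p q hs
      have e1 := hs.le 1 0 (X w) (by rw [hXb, hXv w hwT]; omega) (by omega)
      obtain ⟨t, t0, t1, t2, t3⟩ := hs
      refine ⟨by simpa using e1, ?_⟩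
      rw [t3, hYb, hYw]; ring
    have hXhw : X w < X (h w) := by
      rw [hXv _ hwT, hXv _ hhwT]; exact_mod_cast hxw
    have hXhw' : (X w : ℝ) < X (h w) := by exact_mod_cast hXhw
    refine ⟨?_, ?_⟩
    · intro v hv hne hs
      obtain ⟨e1, e2⟩ := hpt _ _ hs
      have := hRow v hv (by exact_mod_cast e2) hne
      subst this
      linarith
    · rintro u hu v hv ⟨hne, e⟩ hu1 hv1 p q s1 s2
      obtain ⟨e1, e2⟩ := hpt _ _ s1
      rcases e with rfl | rfl | rfl
      · have := H.1.1.xf u hu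
        rw [hXv _ hv, hXv _ hu, this, hYb, hYw]; ring
      · exfalso
        obtain ⟨t, t0, t1, t2, t3⟩ := s2
        have e3 : Y (rem b h u) = Y u := by rw [hYv _ hv, hYv _ hu, H.1.2.xf u hu]
        rw [e3] at t3
        have e4 : (Y u : ℝ) = Y w := by rw [← e2, t3]; ring
        have e5 := hRow u hu (by exact_mod_cast e4) hu1
        have e6 := hRow _ hv (by rw [e3]; exact_mod_cast e4) hv1
        exact hne (e5.trans e6.symm)
      · exfalso
        have gx := hG.gx I' u hu hne
        have gy := hG.swap.gx I'.swap u hu hne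
        rw [← hYv u hu, ← hYv _ hv] at gy
        have gx' : X u ≠ X (rem b g u) := by rw [hXv _ hu, hXv _ hv]; exact gx
        rcases s2.cases gx' gy with d | d | ⟨-, d⟩
        · have := hRow u hu (by exact_mod_cast (d.2.symm.trans e2)) hu1
          subst this
          linarith [d.1]
        · have := hRow _ hv (by exact_mod_cast (d.2.symm.trans e2)) hv1
          rw [this] at d
          linarith [d.1]
        · rw [e2] at d
          norm_cast at d
          rw [hYv _ hu, hYv _ hv, hYv _ hwT, hψ.lt_iff_lt, hψ.lt_iff_lt, hψ.lt_iff_lt,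
            hψ.lt_iff_lt] at d
          have hl := B.xw
          by_cases hc : u ∈ cy
          · have := B.cc u hc
            have := B.cc _ (H.1.2.cgc u hc)
            omega
          · have := H.1.2.nc u hu hc (fun h => hne h.symm)
            omega
  · intro v hv
    have := A.card
    have := A.k2
    have := A.kk
    by_cases e : v = b
    · rw [e, hXb]; omega
    · have hv' : v ∈ T.erase b := Finset.mem_erase.2 ⟨e, hv⟩
      rw [hXv v hv']
      have := hkx v hv'
      omega
  · intro v hv
    have := B.card
    have := B.k2
    have := B.kk
    by_cases e : v = b
    · rw [e, hYb]; omega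
    · have hv' : v ∈ T.erase b := Finset.mem_erase.2 ⟨e, hv⟩
      rw [hYv v hv', stretch]
      have := hky v hv'
      split_ifs <;> omega

end Cubic

section Assemble
set_option linter.unusedSectionVars false
variable {V : Type} [Fintype V]

lemma draw_case2 {f h g : V → V} (I : Inv3 f h g) (T : Finset V)
    (hT : Clo3 f h g (T : Set V))
    (hmin : ∀ P : Set V, Clo3 f h g P → (∃ v ∈ T, v ∈ P) → (T : Set V) ⊆ P)
    (hcub : ∀ v ∈ T, f v ≠ v ∧ h v ≠ v ∧ g v ≠ v) (b : V) (hb : b ∈ T)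
    (hcl : ∀ v ∈ T, h v ∈ cls f g v) : Drawn (Edg f h g) T := by
  obtain ⟨x, y, kx, ky, cx, cy, C, D, k, l0, H, A, B⟩ := cubic_setup I T hT hmin hcub b hb
  have hcT : (T.erase b).card + 1 = T.card := Finset.card_erase_add_one hb
  have I' := I.rem b
  have hCT : ∀ v ∈ T.erase b, v ∈ C := by
    have st : ∀ m : V → V, ∀ v, v ≠ b → rem b m v ∈ (C : Set V) → m v ∈ insert b (C : Set V) := by
      intro m v hvb hv
      unfold rem at hv
      split_ifs at hv with hc
      · rcases hc with hc | hc
        · exact absurd hc hvb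
        · exact Or.inl hc
      · exact Or.inr hv
    have c2 : Clo2 f g (insert b (C : Set V)) := by
      intro v hv
      by_cases hvb : v = b
      · subst hvb
        exact ⟨Or.inr A.aC, Or.inr A.wC⟩
      · have hvC : v ∈ C := by
          rcases hv with hv | hv
          · exact absurd hv hvb
          · exact hv
        exact ⟨st f v hvb (A.clf v hvC), st g v hvb (A.clg v hvC)⟩
    have c3 : (T : Set V) ⊆ insert b (C : Set V) := by
      refine hmin _ ?_ ⟨b, hb, Or.inl rfl⟩
      intro v hv
      have hvT : v ∈ T := by
        rcases hv with rfl | hv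
        · exact hb
        · exact (Finset.mem_erase.1 (A.sub v hv)).2
      exact ⟨(c2 v hv).1, hcl v hvT _ c2 hv, (c2 v hv).2⟩
    intro v hv
    have hv' := Finset.mem_erase.1 hv
    rcases c3 hv'.2 with e | e
    · exact absurd e hv'.1
    · exact e
  have hk : ∀ v ∈ T.erase b, x v < k := fun v hv => A.inn v (hCT v hv)
  have hky := H.1.2.lt
  have k2 := A.k2
  have hl2 : 2 ≤ ky := B.k2.trans B.kk
  have hφ : StrictMono (stretch (3 - 2 * (k : ℤ))) := stretch_mono (by omega)
  have hψ : StrictMono (stretch (1 - 2 * (ky : ℤ))) := stretch_mono (by omega)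
  have hG := stt_geo I'.gg H _ _ hφ hψ
  obtain ⟨X, hX⟩ : ∃ X : V → ℤ, X = fun v => if v = b then 2 * (k : ℤ) - 1 else
    stretch (3 - 2 * (k : ℤ)) (x v) := ⟨_, rfl⟩
  obtain ⟨Y, hY⟩ : ∃ Y : V → ℤ, Y = fun v => if v = b then 2 * (ky : ℤ) else
    stretch (1 - 2 * (ky : ℤ)) (y v) := ⟨_, rfl⟩
  have hXb : X b = 2 * k - 1 := by simp [hX]
  have hYb : Y b = 2 * ky := by simp [hY]
  have hXv : ∀ v ∈ T.erase b, X v = stretch (3 - 2 * (k : ℤ)) (x v) := by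
    intro v hv; simp [hX, (Finset.mem_erase.1 hv).1]
  have hYv : ∀ v ∈ T.erase b, Y v = stretch (1 - 2 * (ky : ℤ)) (y v) := by
    intro v hv; simp [hY, (Finset.mem_erase.1 hv).1]
  clear hX hY
  have hR := (geo_rac I' hG).congr (fun _ _ _ _ e => e) hXv hYv
  have haT := A.sub _ A.aC
  have hwT := A.sub _ A.wC
  have hb'T := B.sub _ B.aC
  have hXa : X (f b) = 3 - 2 * k := by rw [hXv _ haT, A.xa]; simp [stretch]
  have hYb' : Y (h b) = 1 - 2 * ky := by rw [hYv _ hb'T, B.xa]; simp [stretch]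
  have hXo : ∀ v ∈ T.erase b, v ≠ f b → 1 ≤ X v ∧ X v = x v := by
    intro v hv hne
    have : x v ≠ 0 := fun e => hne (A.un v hv e)
    rw [hXv v hv, stretch, if_neg this]
    omega
  have hYo : ∀ v ∈ T.erase b, v ≠ h b → 1 ≤ Y v ∧ Y v = y v := by
    intro v hv hne
    have : y v ≠ 0 := fun e => hne (B.un v hv e)
    rw [hYv v hv, stretch, if_neg this]
    omega
  have hXk : ∀ v ∈ T.erase b, 3 - 2 * (k : ℤ) ≤ X v ∧ X v ≤ k - 1 := by
    intro v hv
    have := hk v hv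
    rw [hXv v hv, stretch]
    split_ifs <;> omega
  have hYk : ∀ v ∈ T.erase b, 1 - 2 * (ky : ℤ) ≤ Y v ∧ Y v ≤ ky - 1 := by
    intro v hv
    have := hky v hv
    rw [hYv v hv, stretch]
    split_ifs <;> omega
  have nab : f b ≠ h b := fun e => (hcub b hb).1 (I.fh b e)
  have nwa : g b ≠ f b := fun e => (hcub b hb).1 (I.fg b e.symm)
  have nwb : g b ≠ h b := fun e => (hcub b hb).2.1 (I.hg b e.symm)
  refine drawn_of (X := X) (Y := Y) (cubic_fin I T hcub b hb X Y hR ?_ ?_ ?_ ?_)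
    (2 * k - 3) (2 * ky - 1) ?_ ?_
  · right
    intro v hv
    have := hXk v hv
    rw [hXb]
    omega
  · obtain ⟨ya, hya⟩ : ∃ ya, ya = Y (f b) := ⟨_, rfl⟩
    have y1 := (hYo _ haT nab).1
    have y2 := (hYk _ haT).2
    rw [← hya] at y1 y2
    refine okay_sep (2 * ky - ya) (-(4 * k - 4))
      ((2 * ky - ya) * (3 - 2 * k) - (4 * k - 4) * ya) ?_ ?_ ?_
    · rw [hXb, hYb]; apply le_of_eq; ring
    · rw [hXa, ← hya]; apply le_of_eq; ring
    · intro v hv hne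
      have q1 := (hXo v hv hne).1
      have q2 := (hYk v hv).2
      have r1 : (2 * (ky : ℤ) - ya) * 1 ≤ (2 * ky - ya) * X v :=
        mul_le_mul_of_nonneg_left q1 (by omega)
      have r2 : (4 * (k : ℤ) - 4) * Y v ≤ (4 * k - 4) * (ky - 1) :=
        mul_le_mul_of_nonneg_left q2 (by omega)
      have r3 : 0 < (2 * (k : ℤ) - 2) * (2 + ya) := mul_pos (by omega) (by omega)
      nlinarith
  · obtain ⟨xb, hxb⟩ : ∃ xb, xb = X (h b) := ⟨_, rfl⟩
    have y1 := (hXo _ hb'T nab.symm).1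
    have y2 := (hXk _ hb'T).2
    rw [← hxb] at y1 y2
    refine okay_sep (-(4 * ky - 1)) (2 * k - 1 - xb)
      ((2 * k - 1 - xb) * (1 - 2 * ky) - (4 * ky - 1) * xb) ?_ ?_ ?_
    · rw [hXb, hYb]; apply le_of_eq; ring
    · rw [hYb', ← hxb]; apply le_of_eq; ring
    · intro v hv hne
      have q1 := (hYo v hv hne).1
      have q2 := (hXk v hv).2
      have r1 : (2 * (k : ℤ) - 1 - xb) * 1 ≤ (2 * k - 1 - xb) * Y v :=
        mul_le_mul_of_nonneg_left q1 (by omega)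
      have r2 : (4 * (ky : ℤ) - 1) * X v ≤ (4 * ky - 1) * (k - 1) :=
        mul_le_mul_of_nonneg_left q2 (by omega)
      have r3 : 0 ≤ (2 * (ky : ℤ)) * xb := mul_nonneg (by omega) (by omega)
      nlinarith
  · have hXw : X (g b) = k - 1 := by
      have := (hXo _ hwT nwa).2
      have := A.xw
      omega
    have y1 := (hYo _ hwT nwb).1
    have y2 := (hYk _ hwT).2
    have hcol : ∀ v ∈ T.erase b, X v = k - 1 → v ≠ g b → v = rem b f (g b) := by
      intro v hv e hne
      rw [← hXw, hXv v hv, hXv _ hwT] at e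
      have := H.1.1.inj v hv _ hwT (hφ.injective e)
      tauto
    have hother : ∀ v ∈ T.erase b, v ≠ g b → v ≠ rem b f (g b) → X v ≤ k - 2 := by
      intro v hv h1 h2
      have := (hXk v hv).2
      by_contra hcon
      exact h2 (hcol v hv (by omega) h1)
    by_cases hs : Y (g b) < Y (rem b f (g b))
    · refine okay_sep (-(4 * ky)) 1 (-(4 * ky) * (k - 1) + Y (g b)) ?_ ?_ ?_
      · rw [hXb, hYb]; nlinarith
      · rw [hXw]; linarith
      · intro v hv hne
        by_cases e : v = rem b f (g b)
        · have e2 : X v = k - 1 := by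
            rw [e, hXv _ (H.1.1.cf _ hwT), H.1.1.xf _ hwT, ← hXv _ hwT, hXw]
          rw [e2, e]; linarith
        · have q1 := hother v hv hne e
          have q2 := (hYk v hv).1
          have r1 : (4 * (ky : ℤ)) * X v ≤ (4 * ky) * (k - 2) :=
            mul_le_mul_of_nonneg_left q1 (by omega)
          nlinarith
    · refine okay_sep (-(4 * ky)) (-1) (-(4 * ky) * (k - 1) - Y (g b)) ?_ ?_ ?_
      · rw [hXb, hYb]; nlinarith
      · rw [hXw]; linarith
      · intro v hv hne
        by_cases e : v = rem b f (g b)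
        · have e2 : X v = k - 1 := by
            rw [e, hXv _ (H.1.1.cf _ hwT), H.1.1.xf _ hwT, ← hXv _ hwT, hXw]
          have e3 : Y v ≠ Y (g b) := fun e3 => hne (hR.inj v hv _ hwT (e2.trans hXw.symm) e3)
          rw [← e] at hs
          have : Y v < Y (g b) := by omega
          rw [e2]; linarith
        · have q1 := hother v hv hne e
          have q2 := (hYk v hv).2
          have r1 : (4 * (ky : ℤ)) * X v ≤ (4 * ky) * (k - 2) :=
            mul_le_mul_of_nonneg_left q1 (by omega)
          nlinarith
  · intro v hv
    have := A.card
    have := A.kk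
    by_cases e : v = b
    · rw [e, hXb]; omega
    · have := hXk v (Finset.mem_erase.2 ⟨e, hv⟩)
      omega
  · intro v hv
    have := B.card
    by_cases e : v = b
    · rw [e, hYb]; omega
    · have := hYk v (Finset.mem_erase.2 ⟨e, hv⟩)
      omega

lemma draw_class {f h g : V → V} (I : Inv3 f h g) (T : Finset V) (hne : T.Nonempty)
    (hT : Clo3 f h g (T : Set V))
    (hmin : ∀ P : Set V, Clo3 f h g P → (∃ v ∈ T, v ∈ P) → (T : Set V) ⊆ P) :
    Drawn (Edg f h g) T := by
  by_cases h1 : ∃ a ∈ T, f a = a ∨ g a = a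
  · obtain ⟨a, ha, hfix⟩ := h1
    exact draw_noncubic I T hT hmin a ha hfix
  by_cases h2 : ∃ a ∈ T, h a = a
  · obtain ⟨a, ha, hfix⟩ := h2
    have hsw : ∀ P : Set V, Clo3 h f g P → Clo3 f h g P :=
      fun P hP v hv => ⟨(hP v hv).2.1, (hP v hv).1, (hP v hv).2.2⟩
    obtain ⟨X, Y, h3, h4⟩ := draw_noncubic I.swap T
      (fun v hv => ⟨(hT v hv).2.1, (hT v hv).1, (hT v hv).2.2⟩)
      (fun P hP => hmin P (hsw P hP)) a ha (Or.inl hfix)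
    exact ⟨X, Y, h3, h4.congr (fun u _ v _ e => e.swap) (fun _ _ => rfl) (fun _ _ => rfl)⟩
  push Not at h1 h2
  have hcub : ∀ v ∈ T, f v ≠ v ∧ h v ≠ v ∧ g v ≠ v :=
    fun v hv => ⟨(h1 v hv).1, h2 v hv, (h1 v hv).2⟩
  by_cases h3 : ∃ w ∈ T, h w ∉ cls f g w
  · obtain ⟨w, hw, hcl⟩ := h3
    exact draw_case1 I T hT hmin hcub w hw hcl
  · push Not at h3
    obtain ⟨b, hb⟩ := hne
    exact draw_case2 I T hT hmin hcub b hb h3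

lemma drawn_union {E : V → V → Prop} {S T : Finset V} (hST : Disjoint S T)
    (hs : ∀ u ∈ S, ∀ v ∈ T, ¬ E u v ∧ ¬ E v u) (h1 : Drawn E S) (h2 : Drawn E T) :
    Drawn E (S ∪ T) := by
  obtain ⟨X, Y, a1, a2⟩ := h1
  obtain ⟨X', Y', b1, b2⟩ := h2
  have hd : ∀ v ∈ T, v ∉ S := fun v h1 h2 => Finset.disjoint_left.1 hST h2 h1
  obtain ⟨X2, hX2⟩ : ∃ X2 : V → ℤ, X2 = fun v => if v ∈ S then X v else X' v + 2 * S.card :=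
    ⟨_, rfl⟩
  obtain ⟨Y2, hY2⟩ : ∃ Y2 : V → ℤ, Y2 = fun v => if v ∈ S then Y v else Y' v + 2 * S.card :=
    ⟨_, rfl⟩
  have c1 : RACOn E S X2 Y2 := a2.congr (fun _ _ _ _ e => e)
    (by intro v hv; simp [hX2, hv]) (by intro v hv; simp [hY2, hv])
  have c2 : RACOn E T X2 Y2 := (b2.shift (2 * S.card) (2 * S.card)).congr (fun _ _ _ _ e => e)
    (by intro v hv; simp [hX2, hd v hv]) (by intro v hv; simp [hY2, hd v hv])
  have d1 : ∀ v ∈ S, 0 ≤ X2 v ∧ X2 v < 2 * S.card ∧ 0 ≤ Y2 v ∧ Y2 v < 2 * S.card := by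
    intro v hv; simpa [hX2, hY2, hv] using a1 v hv
  have d2 : ∀ v ∈ T, 2 * S.card ≤ X2 v ∧ X2 v < 2 * S.card + 2 * T.card ∧
      2 * S.card ≤ Y2 v ∧ Y2 v < 2 * S.card + 2 * T.card := by
    intro v hv
    have := b1 v hv
    simp only [hX2, hY2, hd v hv, if_false]
    omega
  clear hX2 hY2
  have hcard := Finset.card_union_of_disjoint hST
  have hnc : ∀ u ∈ S, ∀ v ∈ S, ∀ s ∈ T, ∀ t ∈ T, ∀ p q, OnSeg X2 Y2 u v p q →
      OnSeg X2 Y2 s t p q → False := by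
    intro u hu v hv s hs t ht p q k1 k2
    have r1 := k1.le 1 0 (2 * S.card - 1) (by have := d1 u hu; omega) (by have := d1 v hv; omega)
    have r2 := k2.gt 1 0 (2 * S.card - 1) (by have := d2 s hs; omega) (by have := d2 t ht; omega)
    linarith
  have self : ∀ w, OnSeg X2 Y2 w w (X2 w) (Y2 w) := fun w =>
    ⟨0, le_rfl, zero_le_one, by ring, by ring⟩
  have hE : ∀ u ∈ S ∪ T, ∀ v ∈ S ∪ T, E u v → (u ∈ S ∧ v ∈ S) ∨ (u ∈ T ∧ v ∈ T) := by
    intro u hu v hv e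
    rcases Finset.mem_union.1 hu with hu | hu <;> rcases Finset.mem_union.1 hv with hv | hv
    · exact Or.inl ⟨hu, hv⟩
    · exact absurd e (hs u hu v hv).1
    · exact absurd e (hs v hv u hu).2
    · exact Or.inr ⟨hu, hv⟩
  refine ⟨X2, Y2, ?_, ?_, ?_, ?_⟩
  · intro v hv
    rw [hcard]
    rcases Finset.mem_union.1 hv with hv | hv
    · have := d1 v hv; push_cast; omega
    · have := d2 v hv; push_cast; omega
  · intro u hu v hv k1 k2
    rcases Finset.mem_union.1 hu with hu | hu <;> rcases Finset.mem_union.1 hv with hv | hv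
    · exact c1.inj u hu v hv k1 k2
    · have := d1 u hu; have := d2 v hv; omega
    · have := d2 u hu; have := d1 v hv; omega
    · exact c2.inj u hu v hv k1 k2
  · intro u hu v hv w hw e k1 k2 hseg
    rcases hE u hu v hv e with ⟨hu, hv⟩ | ⟨hu, hv⟩ <;> rcases Finset.mem_union.1 hw with hw | hw
    · exact c1.off u hu v hv w hw e k1 k2 hseg
    · exact hnc u hu v hv w hw w hw _ _ hseg (self w)
    · exact hnc w hw w hw u hu v hv _ _ (self w) hseg
    · exact c2.off u hu v hv w hw e k1 k2 hseg
  · intro u hu v hv u' hu' v' hv' e e' k1 k2 k3 k4 p q s1 s2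
    rcases hE u hu v hv e with ⟨hu, hv⟩ | ⟨hu, hv⟩ <;>
      rcases hE u' hu' v' hv' e' with ⟨hu', hv'⟩ | ⟨hu', hv'⟩
    · exact c1.rac u hu v hv u' hu' v' hv' e e' k1 k2 k3 k4 p q s1 s2
    · exact (hnc u hu v hv u' hu' v' hv' _ _ s1 s2).elim
    · exact (hnc u' hu' v' hv' u hu v hv _ _ s2 s1).elim
    · exact c2.rac u hu v hv u' hu' v' hv' e e' k1 k2 k3 k4 p q s1 s2

lemma Clo3.compl {f h g : V → V} (I : Inv3 f h g) {P : Set V} (hP : Clo3 f h g P) :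
    Clo3 f h g Pᶜ := by
  intro v hv
  refine ⟨fun k => hv ?_, fun k => hv ?_, fun k => hv ?_⟩
  · have := (hP _ k).1
    rwa [I.ff] at this
  · have := (hP _ k).2.1
    rwa [I.hh] at this
  · have := (hP _ k).2.2
    rwa [I.gg] at this

lemma Clo3.inter {f h g : V → V} {P Q : Set V} (hP : Clo3 f h g P) (hQ : Clo3 f h g Q) :
    Clo3 f h g (P ∩ Q) := fun v hv =>
  ⟨⟨(hP v hv.1).1, (hQ v hv.2).1⟩, ⟨(hP v hv.1).2.1, (hQ v hv.2).2.1⟩,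
    ⟨(hP v hv.1).2.2, (hQ v hv.2).2.2⟩⟩

lemma draw_closed {f h g : V → V} (I : Inv3 f h g) : ∀ n : ℕ, ∀ S : Finset V, S.card ≤ n →
    Clo3 f h g (S : Set V) → Drawn (Edg f h g) S := by
  intro n
  induction n with
  | zero =>
    intro S hS _
    have : S = ∅ := by simpa using hS
    subst this
    refine ⟨fun _ => 0, fun _ => 0, by simp, by simp, by simp, by simp⟩
  | succ n ih =>
    intro S hS hc
    by_cases hne : S.Nonempty
    · obtain ⟨a, ha⟩ := hne
      obtain ⟨K, hK⟩ : ∃ K : Set V, K = {v | ∀ P, Clo3 f h g P → a ∈ P → v ∈ P} := ⟨_, rfl⟩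
      have hKm : ∀ v, v ∈ K ↔ ∀ P, Clo3 f h g P → a ∈ P → v ∈ P := by intro v; rw [hK]; rfl
      have hKa : a ∈ K := (hKm a).2 fun P _ h => h
      have hKc : Clo3 f h g K := by
        intro v hv
        rw [hKm] at hv
        exact ⟨(hKm _).2 fun P hP h => (hP v (hv P hP h)).1,
          (hKm _).2 fun P hP h => (hP v (hv P hP h)).2.1,
          (hKm _).2 fun P hP h => (hP v (hv P hP h)).2.2⟩
      obtain ⟨T, hT⟩ : ∃ T : Finset V, T = S.filter (fun v => v ∈ K) := ⟨_, rfl⟩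
      have hTm : ∀ v, v ∈ T ↔ v ∈ K := by
        intro v
        rw [hT, Finset.mem_filter]
        exact ⟨fun k => k.2, fun k => ⟨(hKm v).1 k _ hc ha, k⟩⟩
      have hTS : T ⊆ S := by rw [hT]; exact Finset.filter_subset _ _
      have hTc : Clo3 f h g (T : Set V) := by
        intro v hv
        have hv' := (hTm v).1 hv
        exact ⟨(hTm _).2 (hKc v hv').1, (hTm _).2 (hKc v hv').2.1, (hTm _).2 (hKc v hv').2.2⟩
      have hD := draw_class I T ⟨a, (hTm a).2 hKa⟩ hTc (by
        rintro P hP ⟨v, hvT, hvP⟩ u hu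
        have haP : a ∈ P := by
          by_contra haP
          exact (hKm v).1 ((hTm v).1 hvT) _ (hP.compl I) haP hvP
        exact (hKm u).1 ((hTm u).1 hu) P hP haP)
      have hRc : Clo3 f h g ((S \ T : Finset V) : Set V) := by
        have := hc.inter (hTc.compl I)
        intro v hv
        rw [Finset.coe_sdiff] at hv ⊢
        exact this v hv
      have hlt : (S \ T).card ≤ n := by
        have : (S \ T).card < S.card := Finset.card_lt_card
          ⟨Finset.sdiff_subset, fun k => (Finset.mem_sdiff.1 (k ha)).2 ((hTm a).2 hKa)⟩
        omega
      have hR := ih _ hlt hRc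
      have := drawn_union Finset.disjoint_sdiff (E := Edg f h g) (S := T) (T := S \ T) ?_ hD hR
      · rwa [Finset.union_sdiff_of_subset hTS] at this
      · intro u hu v hv
        have key : ¬ Edg f h g u v := by
          rintro ⟨_, e⟩
          apply (Finset.mem_sdiff.1 hv).2
          rcases e with rfl | rfl | rfl
          · exact (hTc u hu).1
          · exact (hTc u hu).2.1
          · exact (hTc u hu).2.2
        exact ⟨key, fun e => key (e.symm I)⟩
    · rw [Finset.not_nonempty_iff_eq_empty] at hne
      subst hne
      refine ⟨fun _ => 0, fun _ => 0, by simp, by simp, by simp, by simp⟩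

end Assemble

section Final
variable {V : Type}

/-- The partner of a vertex in a matching. -/
def mate (M : Set (Sym2 V)) (v : V) : V := if h : ∃ w, s(v, w) ∈ M then h.choose else v

lemma mate_eq {G : SimpleGraph V} {M : Set (Sym2 V)} (hM : IsMatchingOn G M) {v w : V}
    (h : s(v, w) ∈ M) : mate M v = w := by
  have hex : ∃ w, s(v, w) ∈ M := ⟨w, h⟩
  have h2 : s(v, hex.choose) ∈ M := hex.choose_spec
  unfold mate
  rw [dif_pos hex]
  by_contra hne
  refine hM.2 _ h2 _ h ?_ v (by simp) (by simp)
  intro e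
  exact hne (Sym2.congr_right.1 e)

lemma mate_ne {M : Set (Sym2 V)} {v : V} (h : mate M v ≠ v) : s(v, mate M v) ∈ M := by
  by_cases hex : ∃ w, s(v, w) ∈ M
  · have h2 : s(v, hex.choose) ∈ M := hex.choose_spec
    unfold mate
    rw [dif_pos hex]
    exact h2
  · exact absurd (by unfold mate; rw [dif_neg hex]) h

lemma mate_inv {G : SimpleGraph V} {M : Set (Sym2 V)} (hM : IsMatchingOn G M) (v : V) :
    mate M (mate M v) = v := by
  by_cases h : mate M v = v
  · rw [h, h]
  · have := mate_ne h
    rw [Sym2.eq_swap] at this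
    exact mate_eq hM this

lemma mate_disj {M M' : Set (Sym2 V)} (hd : Disjoint M M') (v : V) (h : mate M v = mate M' v) :
    mate M v = v := by
  by_contra hne
  have h1 := mate_ne hne
  have h2 : s(v, mate M' v) ∈ M' := mate_ne (by rw [← h]; exact hne)
  rw [← h] at h2
  exact Set.disjoint_left.1 hd h1 h2

lemma onSeg_of_mem {X Y : V → ℤ} {u v : V} {q : Pt}
    (h : q ∈ segment ℝ (((X u : ℝ), (Y u : ℝ)) : Pt) (((X v : ℝ), (Y v : ℝ)) : Pt)) :
    OnSeg X Y u v q.1 q.2 := by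
  obtain ⟨a, b, ha, hb, hab, rfl⟩ := h
  refine ⟨b, hb, by linarith, ?_, ?_⟩
  · have : a = 1 - b := by linarith
    simp [this]
  · have : a = 1 - b := by linarith
    simp [this]

/-- Two segments from a common point meet only there unless one contains the other end. -/
lemma seg_shared {a b c : Pt} (h1 : c ∉ segment ℝ a b) (h2 : b ∉ segment ℝ a c) :
    segment ℝ a b ∩ segment ℝ a c ⊆ {a} := by
  rintro q ⟨hq1, hq2⟩
  rw [segment_eq_image'] at hq1 hq2
  obtain ⟨t, ⟨t0, t1⟩, rfl⟩ := hq1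
  obtain ⟨r, ⟨r0, r1⟩, e⟩ := hq2
  simp only at e
  have e' : r • (c - a) = t • (b - a) := add_left_cancel e
  by_contra hne
  have hne' : t • (b - a) ≠ 0 := by
    intro h0
    apply hne
    simp [h0]
  have ht : 0 < t := lt_of_le_of_ne t0 (by rintro rfl; simp at hne')
  have hr : 0 < r := lt_of_le_of_ne r0 (by rintro rfl; rw [← e'] at hne'; simp at hne')
  rcases le_total t r with h | h
  · apply h1
    rw [segment_eq_image']
    refine ⟨t / r, ⟨by positivity, (div_le_one hr).2 h⟩, ?_⟩
    have : c - a = (t / r) • (b - a) := by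
      rw [div_eq_inv_mul, mul_smul, ← e', smul_smul, inv_mul_cancel₀ hr.ne', one_smul]
    simp only
    rw [← this]
    abel
  · apply h2
    rw [segment_eq_image']
    refine ⟨r / t, ⟨by positivity, (div_le_one ht).2 h⟩, ?_⟩
    have : b - a = (r / t) • (c - a) := by
      rw [div_eq_inv_mul, mul_smul, e', smul_smul, inv_mul_cancel₀ ht.ne', one_smul]
    simp only
    rw [← this]
    abel

end Final


/-- Every 3-edge-colorable graph with maximum degree 3 on `n` vertices
admits a straight-line RAC drawing with all vertices on integer grid points inside a
square of side `2 * n` (hence of `O(n²)` area). -/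
theorem stmt0 (V : Type) [Fintype V] (G : SimpleGraph V)
    (hdeg : ∀ v : V, vdeg G v ≤ 3) (hcol : EdgeColorable G 3) :
    ∃ p : V → Pt, IsRACDrawing G p ∧
      InGridSquare (2 * (Fintype.card V : ℝ)) (Set.range p) := by
  obtain ⟨M, hM, hdis, hun⟩ := hcol
  have I : Inv3 (mate (M 0)) (mate (M 1)) (mate (M 2)) :=
    ⟨mate_inv (hM 0), mate_inv (hM 1), mate_inv (hM 2), mate_disj (hdis 0 1 (by decide)),
      mate_disj (hdis 0 2 (by decide)), mate_disj (hdis 1 2 (by decide))⟩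
  have hE : ∀ u v, G.Adj u v → Edg (mate (M 0)) (mate (M 1)) (mate (M 2)) u v := by
    intro u v huv
    refine ⟨huv.ne, ?_⟩
    have : s(u, v) ∈ ⋃ i, M i := by rw [hun]; exact huv
    obtain ⟨i, hi⟩ := Set.mem_iUnion.1 this
    have := mate_eq (hM i) hi
    fin_cases i
    · exact Or.inl this.symm
    · exact Or.inr (Or.inl this.symm)
    · exact Or.inr (Or.inr this.symm)
  obtain ⟨X, Y, hbd, hR⟩ := draw_closed I (Finset.univ : Finset V).card Finset.univ le_rfl
    (fun v _ => ⟨by simp, by simp, by simp⟩)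
  have mu : ∀ v : V, v ∈ (Finset.univ : Finset V) := Finset.mem_univ
  have hinj : Function.Injective (fun v => (((X v : ℝ), (Y v : ℝ)) : Pt)) := by
    intro u v h
    simp only [Prod.mk.injEq, Int.cast_inj] at h
    exact hR.inj u (mu u) v (mu v) h.1 h.2
  have hoff : ∀ u v w : V, G.Adj u v → w ≠ u → w ≠ v →
      (((X w : ℝ), (Y w : ℝ)) : Pt) ∉
        segment ℝ (((X u : ℝ), (Y u : ℝ)) : Pt) (((X v : ℝ), (Y v : ℝ)) : Pt) := by
    intro u v w huv h1 h2 hseg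
    exact hR.off u (mu u) v (mu v) w (mu w) (hE u v huv) h1 h2 (onSeg_of_mem hseg)
  refine ⟨fun v => ((X v : ℝ), (Y v : ℝ)), ⟨hinj, hoff, ?_, ?_⟩, ?_, 0, 0, ?_⟩
  · intro u v w huv huw hvw
    exact seg_shared (hoff u v w huv huw.ne.symm hvw.symm) (hoff u w v huw huv.ne.symm hvw)
  · rintro u v u' v' huv huv' h1 h2 h3 h4 ⟨q, hq1, hq2⟩
    have := hR.rac u (mu u) v (mu v) u' (mu _) v' (mu _) (hE u v huv) (hE _ _ huv') h1 h2 h3 h4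
      q.1 q.2 (onSeg_of_mem hq1) (onSeg_of_mem hq2)
    simp only [SegOrth]
    exact_mod_cast this
  · rintro q ⟨v, rfl⟩
    exact ⟨X v, Y v, rfl⟩
  · rintro q ⟨v, rfl⟩
    obtain ⟨b1, b2, b3, b4⟩ := hbd v (mu v)
    rw [Finset.card_univ] at b2 b4
    have c1 : (0 : ℝ) ≤ X v := by exact_mod_cast b1
    have c2 : (X v : ℝ) < 2 * (Fintype.card V : ℝ) := by exact_mod_cast b2
    have c3 : (0 : ℝ) ≤ Y v := by exact_mod_cast b3
    have c4 : (Y v : ℝ) < 2 * (Fintype.card V : ℝ) := by exact_mod_cast b4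
    refine ⟨c1, ?_, c3, ?_⟩
    · simp only; linarith
    · simp only; linarith
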